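/- Let μ = m∘Π⁻¹ be a pushforward quasi-Bernoulli measure supported on the attractor F. Suppose there are constants h(μ) ≤ 0 and χ₂(μ) ≤ χ₁(μ) < 0 such that for m-almost every i ∈ Σ: lim_{n→∞} (1/n) log m([i|n]) = h(μ), lim_{n→∞} (1/n) log α₁(D_{Π(σⁿi)} S_{i|n}) = χ₁(μ), and lim_{n→∞} (1/n) log α₂(D_{Π(σⁿi)} S_{i|n}) = χ₂(μ), and suppose π(μ) is exact dimensional with exact dimension t. Then μ is exact dimensional and its exact dimension equals h(μ)/χ₂(μ) + ((χ₂(μ) − χ₁(μ))/χ₂(μ))·t. -/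

import Mathlib

open MeasureTheory Filter Set

noncomputable section

namespace FFL

/-- The unit square `[0,1]² ⊆ ℝ²`. -/
def sq : Set (ℝ × ℝ) := Set.Icc (0:ℝ) 1 ×ˢ Set.Icc (0:ℝ) 1

/-- The Euclidean metric on `ℝ²`. -/
def dE (a b : ℝ × ℝ) : ℝ := Real.sqrt ((a.1 - b.1) ^ 2 + (a.2 - b.2) ^ 2)

/-- Squared Frobenius norm of a 2×2 real matrix. -/
def frobSq (A : Matrix (Fin 2) (Fin 2) ℝ) : ℝ := ∑ i, ∑ j, (A i j) ^ 2

/-- The larger singular value `α₁` of a 2×2 real matrix, i.e. the larger positive square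
root of the eigenvalues of `AᵀA`, via the standard closed formula. -/
def sv1 (A : Matrix (Fin 2) (Fin 2) ℝ) : ℝ :=
  Real.sqrt ((frobSq A + Real.sqrt ((frobSq A) ^ 2 - 4 * (A.det) ^ 2)) / 2)

/-- The smaller singular value `α₂` of a 2×2 real matrix. -/
def sv2 (A : Matrix (Fin 2) (Fin 2) ℝ) : ℝ :=
  Real.sqrt ((frobSq A - Real.sqrt ((frobSq A) ^ 2 - 4 * (A.det) ^ 2)) / 2)

/-- The nonlinear, non-conformal iterated function systems of Falconer, Fraser and Lee:
maps `S i (a₁,a₂) = (f i a₁, g i (a₁,a₂))` on the unit square, where `f i`, `g i` are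
`C^{1+α}` contractions (with partial derivatives `fx`, `gx`, `gy`) satisfying the
domination condition. -/
structure System (I : Type) [Fintype I] where
  f : I → ℝ → ℝ
  g : I → ℝ × ℝ → ℝ
  fx : I → ℝ → ℝ
  gx : I → ℝ × ℝ → ℝ
  gy : I → ℝ × ℝ → ℝ
  /-- the index set has at least two elements -/
  card2 : 2 ≤ Fintype.card I
  /-- each `S i` maps the unit square into itself -/
  mapsTo : ∀ i, Set.MapsTo (fun a => (f i a.1, g i a)) sq sq
  /-- `fx i` is the derivative of `f i` on `[0,1]` -/
  hasDeriv_f : ∀ i, ∀ x ∈ Set.Icc (0:ℝ) 1,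
    HasDerivWithinAt (f i) (fx i x) (Set.Icc (0:ℝ) 1) x
  /-- `(gx i, gy i)` is the (total) derivative of `g i` on the unit square -/
  hasDeriv_g : ∀ i, ∀ a ∈ sq, HasFDerivWithinAt (g i)
      (gx i a • ContinuousLinearMap.fst ℝ ℝ ℝ + gy i a • ContinuousLinearMap.snd ℝ ℝ ℝ) sq a
  /-- the derivatives are `α`-Hölder for some `α > 0`, i.e. `f i`, `g i` are `C^{1+α}` -/
  holder : ∃ α > (0:ℝ), ∃ H > (0:ℝ), ∀ i,
      (∀ x ∈ Set.Icc (0:ℝ) 1, ∀ y ∈ Set.Icc (0:ℝ) 1, |fx i x - fx i y| ≤ H * |x - y| ^ α) ∧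
      (∀ a ∈ sq, ∀ b ∈ sq, |gx i a - gx i b| ≤ H * dE a b ^ α) ∧
      (∀ a ∈ sq, ∀ b ∈ sq, |gy i a - gy i b| ≤ H * dE a b ^ α)
  /-- the maps `f i`, `g i` (hence `S i`) are uniform contractions -/
  contracting : ∃ c, 0 ≤ c ∧ c < 1 ∧ ∀ i,
      (∀ x ∈ Set.Icc (0:ℝ) 1, ∀ y ∈ Set.Icc (0:ℝ) 1, |f i x - f i y| ≤ c * |x - y|) ∧
      (∀ a ∈ sq, ∀ b ∈ sq, |g i a - g i b| ≤ c * dE a b) ∧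
      (∀ a ∈ sq, ∀ b ∈ sq, dE (f i a.1, g i a) (f i b.1, g i b) ≤ c * dE a b)
  /-- the domination condition:
  `inf |f_{i,x}| > sup |g_{i,y}| ≥ inf |g_{i,y}| ≥ d > 0` -/
  domination : ∃ d > (0:ℝ), ∀ i,
      d ≤ sInf ((fun a => |gy i a|) '' sq) ∧
      sSup ((fun a => |gy i a|) '' sq) < sInf ((fun x => |fx i x|) '' Set.Icc (0:ℝ) 1)

variable {I : Type} [Fintype I]

/-- The map `S i`. -/
def S (T : System I) (i : I) (a : ℝ × ℝ) : ℝ × ℝ := (T.f i a.1, T.g i a)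

/-- The composition `S_w = S_{i₁} ∘ ⋯ ∘ S_{i_n}` along a finite word `w = (i₁,…,i_n)`. -/
def Sw (T : System I) : List I → ℝ × ℝ → ℝ × ℝ
  | [], a => a
  | i :: w, a => S T i (Sw T w a)

/-- The top-left entry `f_{w,x}(a)` of the (lower triangular) Jacobian `D_a S_w`,
via the chain rule. -/
def fxw (T : System I) : List I → ℝ × ℝ → ℝ
  | [], _ => 1
  | i :: w, a => T.fx i (Sw T w a).1 * fxw T w a

/-- The bottom-right entry `g_{w,y}(a)` of the Jacobian `D_a S_w`. -/
def gyw (T : System I) : List I → ℝ × ℝ → ℝ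
  | [], _ => 1
  | i :: w, a => T.gy i (Sw T w a) * gyw T w a

/-- The off-diagonal entry `g_{w,x}(a)` of the Jacobian `D_a S_w`. -/
def gxw (T : System I) : List I → ℝ × ℝ → ℝ
  | [], _ => 0
  | i :: w, a => T.gx i (Sw T w a) * fxw T w a + T.gy i (Sw T w a) * gxw T w a

/-- The Jacobian matrix `D_a S_w`. -/
def Dmat (T : System I) (w : List I) (a : ℝ × ℝ) : Matrix (Fin 2) (Fin 2) ℝ :=
  !![fxw T w a, 0; gxw T w a, gyw T w a]

/-- The larger singular value `α₁(D_a S_w)`. -/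
def alpha1 (T : System I) (w : List I) (a : ℝ × ℝ) : ℝ := sv1 (Dmat T w a)

/-- The smaller singular value `α₂(D_a S_w)`. -/
def alpha2 (T : System I) (w : List I) (a : ℝ × ℝ) : ℝ := sv2 (Dmat T w a)

/-- The restriction `i|n` of an infinite sequence to its first `n` symbols. -/
def word (ii : ℕ → I) (n : ℕ) : List I := List.ofFn (fun k : Fin n => ii k.1)

/-- The iterated left shift `σⁿ`. -/
def shiftn (ii : ℕ → I) (n : ℕ) : ℕ → I := fun k => ii (k + n)

/-- The left shift `σ` on `Σ = I^ℕ`. -/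
def shift (ii : ℕ → I) : ℕ → I := fun k => ii (k + 1)

/-- The cylinder set `[w] ⊆ Σ` of a finite word `w`. -/
def cyl (w : List I) : Set (ℕ → I) := {jj | ∀ k : Fin w.length, jj k.1 = w.get k}

/-- `F` is the attractor of the IFS: the (unique) nonempty compact subset of the unit
square with `F = ⋃ i, S i '' F`. -/
def IsAttractor (T : System I) (F : Set (ℝ × ℝ)) : Prop :=
  F.Nonempty ∧ IsCompact F ∧ F ⊆ sq ∧ F = ⋃ i, S T i '' F

/-- The strong separation condition: the sets `S i '' F` are pairwise disjoint. -/
def SSC (T : System I) (F : Set (ℝ × ℝ)) : Prop :=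
  ∀ i j : I, i ≠ j → Disjoint (S T i '' F) (S T j '' F)

/-- `Pi` is the canonical coding map `Π : Σ → [0,1]²`:
`Π(i)` is the unique point of `⋂ₙ S_{i|n}([0,1]²)`. -/
def IsCoding (T : System I) (Pi : (ℕ → I) → ℝ × ℝ) : Prop :=
  ∀ ii : ℕ → I, ∀ n : ℕ, Pi ii ∈ Sw T (word ii n) '' sq

/-- `m` is quasi-Bernoulli with constant `L`:
`L⁻¹ m[w] m[v] ≤ m[wv] ≤ L m[w] m[v]` for all finite words `w, v`. -/
def QuasiBernoulli [MeasurableSpace I] (m : Measure (ℕ → I)) (L : ℝ) : Prop :=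
  0 < L ∧ ∀ w v : List I,
    L⁻¹ * (m (cyl w)).toReal * (m (cyl v)).toReal ≤ (m (cyl (w ++ v))).toReal ∧
    (m (cyl (w ++ v))).toReal ≤ L * (m (cyl w)).toReal * (m (cyl v)).toReal

/-- The interval `Q₁(x,r) = [x - r/2, x + r/2]`. -/
def Q1 (x r : ℝ) : Set ℝ := Set.Icc (x - r / 2) (x + r / 2)

/-- The square `Q₂(a,r) = (a₁ - r/2, a₁ + r/2) × (a₂ - r/2, a₂ + r/2)`. -/
def Q2 (a : ℝ × ℝ) (r : ℝ) : Set (ℝ × ℝ) :=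
  Set.Ioo (a.1 - r / 2) (a.1 + r / 2) ×ˢ Set.Ioo (a.2 - r / 2) (a.2 + r / 2)

/-- The approximate square `B_n(a,r)`: points `b ∈ S_w([0,1]²)` with `|b₁ - a₁| ≤ r/2`. -/
def Bn (T : System I) (w : List I) (a : ℝ × ℝ) (r : ℝ) : Set (ℝ × ℝ) :=
  {b ∈ Sw T w '' sq | |b.1 - a.1| ≤ r / 2}

/-- The closed Euclidean ball in `ℝ²`. -/
def ballE (x : ℝ × ℝ) (r : ℝ) : Set (ℝ × ℝ) := {y | dE x y ≤ r}

/-- A measure on `ℝ` is exact dimensional with dimension `s` if for a.e. `x`,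
`log ν(B(x,r)) / log r → s` as `r → 0⁺`. -/
def ExactDim1 (ν : Measure ℝ) (s : ℝ) : Prop :=
  ∀ᵐ x ∂ν, Tendsto (fun r => Real.log (ν (Metric.closedBall x r)).toReal / Real.log r)
    (nhdsWithin 0 (Set.Ioi 0)) (nhds s)

/-- A measure on `ℝ²` is exact dimensional with dimension `s` (w.r.t. Euclidean balls). -/
def ExactDim2 (ν : Measure (ℝ × ℝ)) (s : ℝ) : Prop :=
  ∀ᵐ x ∂ν, Tendsto (fun r => Real.log (ν (ballE x r)).toReal / Real.log r)
    (nhdsWithin 0 (Set.Ioi 0)) (nhds s)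

/-- `η = sup_{i ∈ I, a, b ∈ [0,1]²} |g_{i,y}(a)| / |f_{i,x}(b)|`. -/
def eta (T : System I) : ℝ :=
  sSup {x : ℝ | ∃ i : I, ∃ a ∈ sq, ∃ b ∈ sq, x = |T.gy i a| / |T.fx i b.1|}

end FFL

open FFL

namespace FFL

section

variable {I : Type} [Fintype I]

/-! ### The Euclidean metric -/

lemma dE_nonneg (a b : ℝ × ℝ) : 0 ≤ dE a b := Real.sqrt_nonneg _

lemma abs_fst_sub_le_dE (a b : ℝ × ℝ) : |a.1 - b.1| ≤ dE a b := by
  apply Real.abs_le_sqrt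
  nlinarith [sq_nonneg (a.2 - b.2)]

lemma abs_snd_sub_le_dE (a b : ℝ × ℝ) : |a.2 - b.2| ≤ dE a b := by
  apply Real.abs_le_sqrt
  nlinarith [sq_nonneg (a.1 - b.1)]

lemma dE_le_add (a b : ℝ × ℝ) : dE a b ≤ |a.1 - b.1| + |a.2 - b.2| := by
  apply Real.sqrt_le_iff.mpr
  refine ⟨by positivity, ?_⟩
  nlinarith [abs_nonneg (a.1 - b.1), abs_nonneg (a.2 - b.2), sq_abs (a.1 - b.1),
    sq_abs (a.2 - b.2), mul_nonneg (abs_nonneg (a.1 - b.1)) (abs_nonneg (a.2 - b.2))]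

lemma dist_le_dE (a b : ℝ × ℝ) : dist a b ≤ dE a b := by
  rw [Prod.dist_eq]
  exact max_le (abs_fst_sub_le_dE a b) (abs_snd_sub_le_dE a b)

lemma continuous_dE : Continuous fun p : (ℝ × ℝ) × (ℝ × ℝ) => dE p.1 p.2 := by
  unfold dE
  fun_prop

lemma isClosed_ballE (x : ℝ × ℝ) (r : ℝ) : IsClosed (ballE x r) := by
  have : Continuous fun y : ℝ × ℝ => dE x y :=
    continuous_dE.comp (Continuous.prodMk continuous_const continuous_id)
  exact isClosed_le this continuous_const

lemma dE_le_two {a b : ℝ × ℝ} (ha : a ∈ sq) (hb : b ∈ sq) : dE a b ≤ 2 := by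
  have h1 : |a.1 - b.1| ≤ 1 := by
    rw [abs_le]; constructor <;> linarith [ha.1.1, ha.1.2, hb.1.1, hb.1.2]
  have h2 : |a.2 - b.2| ≤ 1 := by
    rw [abs_le]; constructor <;> linarith [ha.2.1, ha.2.2, hb.2.1, hb.2.2]
  linarith [dE_le_add a b]

lemma zero_mem_sq : ((0 : ℝ), (0 : ℝ)) ∈ sq := by simp [sq]

/-! ### Iterated maps -/

lemma Sw_mem (T : System I) (w : List I) {a : ℝ × ℝ} (ha : a ∈ sq) : Sw T w a ∈ sq := by
  induction w with
  | nil => exact ha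
  | cons i w ih => exact T.mapsTo i ih

lemma Sw_append (T : System I) (w v : List I) (a : ℝ × ℝ) :
    Sw T (w ++ v) a = Sw T w (Sw T v a) := by
  induction w with
  | nil => rfl
  | cons i w ih => simp only [List.cons_append, Sw, ih]

lemma gyw_append (T : System I) (w v : List I) (a : ℝ × ℝ) :
    gyw T (w ++ v) a = gyw T w (Sw T v a) * gyw T v a := by
  induction w with
  | nil => simp [gyw]
  | cons i w ih => simp only [List.cons_append, gyw, ih, Sw_append, mul_assoc]

lemma Sw_fst (T : System I) (w : List I) {a b : ℝ × ℝ} (h : a.1 = b.1) :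
    (Sw T w a).1 = (Sw T w b).1 := by
  induction w with
  | nil => exact h
  | cons i w ih => simp only [Sw, S, ih]

lemma dE_Sw_le (T : System I) : ∃ c : ℝ, 0 ≤ c ∧ c < 1 ∧ ∀ w : List I, ∀ a ∈ sq, ∀ b ∈ sq,
    dE (Sw T w a) (Sw T w b) ≤ 2 * c ^ w.length := by
  obtain ⟨c, h0, h1, hc⟩ := T.contracting
  refine ⟨c, h0, h1, fun w a ha b hb => ?_⟩
  induction w with
  | nil => simpa [Sw] using dE_le_two ha hb
  | cons i w ih =>
    calc dE (Sw T (i :: w) a) (Sw T (i :: w) b)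
        ≤ c * dE (Sw T w a) (Sw T w b) :=
          (hc i).2.2 _ (Sw_mem T w ha) _ (Sw_mem T w hb)
      _ ≤ c * (2 * c ^ w.length) := by gcongr
      _ = 2 * c ^ (i :: w).length := by simp [pow_succ]; ring

/-! ### Derivative bounds for the generators -/

lemma abs_le_of_holder {u : ℝ × ℝ → ℝ} {H α : ℝ} (hH : 0 < H) (hα : 0 < α)
    (hu : ∀ a ∈ sq, ∀ b ∈ sq, |u a - u b| ≤ H * dE a b ^ α) {a : ℝ × ℝ} (ha : a ∈ sq) :
    |u a| ≤ |u (0, 0)| + H * 2 ^ α := by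
  have h1 := hu a ha (0, 0) zero_mem_sq
  have h2 : dE a (0, 0) ^ α ≤ 2 ^ α :=
    Real.rpow_le_rpow (dE_nonneg _ _) (dE_le_two ha zero_mem_sq) hα.le
  have h3 : |u a| ≤ |u (0, 0)| + |u a - u (0, 0)| := by
    have := abs_add_le (u (0, 0)) (u a - u (0, 0))
    simpa using this
  nlinarith [mul_le_mul_of_nonneg_left h2 hH.le]

lemma exists_eq_slope {u u' : ℝ → ℝ} (hu : ∀ x ∈ Icc (0 : ℝ) 1,
    HasDerivWithinAt u (u' x) (Icc 0 1) x) {a b : ℝ} (ha : a ∈ Icc (0 : ℝ) 1)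
    (hb : b ∈ Icc (0 : ℝ) 1) : ∃ ξ ∈ Icc (0 : ℝ) 1, u b - u a = u' ξ * (b - a) := by
  wlog hab : a < b generalizing a b with H
  · rcases eq_or_lt_of_le (not_lt.mp hab) with h | h
    · exact ⟨a, ha, by simp [h]⟩
    · obtain ⟨ξ, h1, h2⟩ := H hb ha h
      exact ⟨ξ, h1, by linarith⟩
  have hsub : Icc a b ⊆ Icc (0 : ℝ) 1 := Icc_subset_Icc ha.1 hb.2
  obtain ⟨ξ, h1, h2⟩ := exists_hasDerivAt_eq_slope u u' hab
    (fun x hx => ((hu x (hsub hx)).mono hsub).continuousWithinAt)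
    (fun x hx => (hu x (hsub (Ioo_subset_Icc_self hx))).hasDerivAt
      (Icc_mem_nhds (ha.1.trans_lt hx.1) (hx.2.trans_le hb.2)))
  refine ⟨ξ, hsub (Ioo_subset_Icc_self h1), ?_⟩
  rw [h2, div_mul_cancel₀ _ (by linarith)]

lemma abs_gy_le_sSup (T : System I) (i : I) {a : ℝ × ℝ} (ha : a ∈ sq) :
    |T.gy i a| ≤ sSup ((fun a => |T.gy i a|) '' sq) := by
  obtain ⟨α, hα, H, hH, hol⟩ := T.holder
  refine le_csSup ⟨|T.gy i (0, 0)| + H * 2 ^ α, ?_⟩ (mem_image_of_mem _ ha)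
  rintro _ ⟨b, hb, rfl⟩
  exact abs_le_of_holder hH hα (hol i).2.2 hb

lemma sInf_le_abs_fx (T : System I) (i : I) {x : ℝ} (hx : x ∈ Icc (0 : ℝ) 1) :
    sInf ((fun x => |T.fx i x|) '' Icc (0 : ℝ) 1) ≤ |T.fx i x| := by
  refine csInf_le ⟨0, ?_⟩ (mem_image_of_mem _ hx)
  rintro _ ⟨b, _, rfl⟩
  exact abs_nonneg _

lemma exists_le_abs_gy (T : System I) : ∃ d : ℝ, 0 < d ∧ ∀ i, ∀ a ∈ sq, d ≤ |T.gy i a| := by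
  obtain ⟨d, hd, h⟩ := T.domination
  refine ⟨d, hd, fun i a ha => (h i).1.trans (csInf_le ⟨0, ?_⟩ (mem_image_of_mem _ ha))⟩
  rintro _ ⟨b, _, rfl⟩
  exact abs_nonneg _

lemma abs_gy_lt_abs_fx (T : System I) (i : I) {a : ℝ × ℝ} (ha : a ∈ sq) {x : ℝ}
    (hx : x ∈ Icc (0 : ℝ) 1) : |T.gy i a| < |T.fx i x| := by
  obtain ⟨d, hd, h⟩ := T.domination
  exact (abs_gy_le_sSup T i ha).trans_lt ((h i).2.trans_le (sInf_le_abs_fx T i hx))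

lemma exists_domination_ratio (T : System I) : ∃ η : ℝ, 0 < η ∧ η < 1 ∧
    ∀ i, ∀ a ∈ sq, ∀ x ∈ Icc (0 : ℝ) 1, |T.gy i a| ≤ η * |T.fx i x| := by
  have key : ∀ i, ∃ η : ℝ, 0 < η ∧ η < 1 ∧
      ∀ a ∈ sq, ∀ x ∈ Icc (0 : ℝ) 1, |T.gy i a| ≤ η * |T.fx i x| := by
    intro i
    obtain ⟨d, hd, h⟩ := T.domination
    set s := sSup ((fun a => |T.gy i a|) '' sq) with hs
    set l := sInf ((fun x => |T.fx i x|) '' Icc (0 : ℝ) 1) with hl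
    have hs0 : 0 < s := by
      obtain ⟨d', hd', h'⟩ := exists_le_abs_gy T
      exact hd'.trans_le ((h' i _ zero_mem_sq).trans (abs_gy_le_sSup T i zero_mem_sq))
    have hsl : s < l := (h i).2
    have hl0 : 0 < l := hs0.trans hsl
    refine ⟨s / l, div_pos hs0 hl0, (div_lt_one hl0).mpr hsl, fun a ha x hx => ?_⟩
    calc |T.gy i a| ≤ s := abs_gy_le_sSup T i ha
      _ = s / l * l := (div_mul_cancel₀ _ hl0.ne').symm
      _ ≤ s / l * |T.fx i x| := by
        gcongr
        exact sInf_le_abs_fx T i hx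
  choose η h0 h1 h2 using key
  have : Nonempty I := Fintype.card_pos_iff.mp (by have := T.card2; omega)
  obtain ⟨i₀, hi₀⟩ := Finite.exists_max η
  exact ⟨η i₀, h0 i₀, h1 i₀, fun i a ha x hx =>
    (h2 i a ha x hx).trans (mul_le_mul_of_nonneg_right (hi₀ i) (abs_nonneg _))⟩

lemma abs_gy_le_one (T : System I) (i : I) {a : ℝ × ℝ} (ha : a ∈ sq) : |T.gy i a| ≤ 1 := by
  obtain ⟨c, h0, h1, hc⟩ := T.contracting
  obtain ⟨ξ, hξ, h⟩ := exists_eq_slope (T.hasDeriv_f i) (left_mem_Icc.mpr zero_le_one)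
    (right_mem_Icc.mpr zero_le_one)
  have h2 := (hc i).1 1 (right_mem_Icc.mpr zero_le_one) 0 (left_mem_Icc.mpr zero_le_one)
  rw [h] at h2
  have h3 := abs_gy_lt_abs_fx T i ha hξ
  norm_num at h2
  linarith

/-! ### Derivatives of the iterated maps -/

lemma hasDerivWithinAt_Sw_fst (T : System I) (w : List I) {s : ℝ} (hs : s ∈ Icc (0 : ℝ) 1) {x : ℝ}
    (hx : x ∈ Icc (0 : ℝ) 1) :
    HasDerivWithinAt (fun x => (Sw T w (x, s)).1) (fxw T w (x, s)) (Icc 0 1) x := by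
  induction w with
  | nil => exact hasDerivWithinAt_id _ _
  | cons i w ih =>
    have hm : MapsTo (fun x => (Sw T w (x, s)).1) (Icc 0 1) (Icc 0 1) :=
      fun y hy => (Sw_mem T w (a := (y, s)) ⟨hy, hs⟩).1
    exact (T.hasDeriv_f i _ (hm hx)).comp x ih hm

lemma hasFDerivWithinAt_Sw_snd (T : System I) (w : List I) {a : ℝ × ℝ} (ha : a ∈ sq) :
    HasFDerivWithinAt (fun a => (Sw T w a).2)
      (gxw T w a • ContinuousLinearMap.fst ℝ ℝ ℝ + gyw T w a • ContinuousLinearMap.snd ℝ ℝ ℝ)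
      sq a := by
  induction w with
  | nil => simpa [gxw, gyw, Sw] using hasFDerivWithinAt_snd
  | cons i w ih =>
    have hm : MapsTo (Sw T w) sq sq := fun b hb => Sw_mem T w hb
    have h1 : HasFDerivWithinAt (fun a => (Sw T w a).1)
        (fxw T w a • ContinuousLinearMap.fst ℝ ℝ ℝ) sq a := by
      have h := (hasDerivWithinAt_Sw_fst T w ha.2 ha.1).hasFDerivWithinAt.comp a
        (hasFDerivWithinAt_fst (𝕜 := ℝ) (s := sq) (p := a))
        (fun b (hb : b ∈ sq) => hb.1)
      have h' : HasFDerivWithinAt (fun b => (Sw T w b).1) _ sq a :=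
        HasFDerivWithinAt.congr h (fun b _ => Sw_fst T w rfl) (Sw_fst T w rfl)
      refine h'.congr_fderiv ?_
      ext <;> simp
    have h2 := (T.hasDeriv_g i _ (hm ha)).comp a (h1.prodMk ih) hm
    refine h2.congr_fderiv ?_
    ext <;> simp [gxw, gyw]

lemma hasDerivWithinAt_horizontal (T : System I) (w : List I) {x s : ℝ}
    (hs : s ∈ Icc (0 : ℝ) 1) (hx : x ∈ Icc (0 : ℝ) 1) :
    HasDerivWithinAt (fun x => (Sw T w (x, s)).2) (gxw T w (x, s)) (Icc 0 1) x := by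
  have h := (hasFDerivWithinAt_Sw_snd T w (a := (x, s)) ⟨hx, hs⟩).comp_hasDerivWithinAt x
    ((hasDerivWithinAt_id x (Icc 0 1)).prodMk (hasDerivWithinAt_const x (Icc 0 1) s))
    (fun y hy => (⟨hy, hs⟩ : ((y, s) : ℝ × ℝ) ∈ sq))
  exact h.congr_deriv (by simp)

lemma hasDerivWithinAt_vertical (T : System I) (w : List I) {x s : ℝ}
    (hx : x ∈ Icc (0 : ℝ) 1) (hs : s ∈ Icc (0 : ℝ) 1) :
    HasDerivWithinAt (fun s => (Sw T w (x, s)).2) (gyw T w (x, s)) (Icc 0 1) s := by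
  have h := (hasFDerivWithinAt_Sw_snd T w (a := (x, s)) ⟨hx, hs⟩).comp_hasDerivWithinAt s
    ((hasDerivWithinAt_const s (Icc 0 1) x).prodMk (hasDerivWithinAt_id s (Icc 0 1)))
    (fun y hy => (⟨hx, hy⟩ : ((x, y) : ℝ × ℝ) ∈ sq))
  exact h.congr_deriv (by simp)

end

section

variable {I : Type} [Fintype I]

/-! ### Bounded distortion -/

lemma exists_distortion_of_cocycle (T : System I) {u : I → ℝ × ℝ → ℝ}
    {U : List I → ℝ × ℝ → ℝ} (hnil : ∀ a, U [] a = 1)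
    (hcons : ∀ i w a, U (i :: w) a = u i (Sw T w a) * U w a)
    {d H α : ℝ} (hd : 0 < d) (hH : 0 < H) (hα : 0 < α)
    (hu : ∀ i, ∀ a ∈ sq, d ≤ |u i a|)
    (hol : ∀ i, ∀ a ∈ sq, ∀ b ∈ sq, |u i a - u i b| ≤ H * dE a b ^ α) :
    ∃ C : ℝ, 1 ≤ C ∧ ∀ w, ∀ a ∈ sq, ∀ b ∈ sq, |U w a| ≤ C * |U w b| := by
  obtain ⟨c, hc0, hc1, hc⟩ := dE_Sw_le T
  set q := c ^ α with hq
  have hq0 : 0 ≤ q := Real.rpow_nonneg hc0 _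
  have hq1 : q < 1 := Real.rpow_lt_one hc0 hc1 hα
  set K := H * 2 ^ α / d with hK
  have hK0 : 0 ≤ K := by positivity
  have main : ∀ w : List I, ∀ a ∈ sq, ∀ b ∈ sq,
      |U w a| ≤ Real.exp (K * ∑ k ∈ Finset.range w.length, q ^ k) * |U w b| := by
    intro w a ha b hb
    induction w with
    | nil => simp [hnil]
    | cons i w ih =>
      have ha' := Sw_mem T w ha
      have hb' := Sw_mem T w hb
      have h1 : dE (Sw T w a) (Sw T w b) ^ α ≤ 2 ^ α * q ^ w.length := by
        calc dE (Sw T w a) (Sw T w b) ^ α ≤ (2 * c ^ w.length) ^ α :=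
              Real.rpow_le_rpow (dE_nonneg _ _) (hc w a ha b hb) hα.le
          _ = 2 ^ α * q ^ w.length := by
              rw [Real.mul_rpow (by norm_num) (by positivity), hq, ← Real.rpow_natCast,
                ← Real.rpow_mul hc0, mul_comm (w.length : ℝ), Real.rpow_mul hc0,
                Real.rpow_natCast]
      have h2 : |u i (Sw T w a)| ≤ |u i (Sw T w b)| * Real.exp (K * q ^ w.length) := by
        have h3 := hol i _ ha' _ hb'
        have h4 : |u i (Sw T w a)| ≤ |u i (Sw T w b)| + |u i (Sw T w a) - u i (Sw T w b)| := by
          have := abs_add_le (u i (Sw T w b)) (u i (Sw T w a) - u i (Sw T w b))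
          simpa using this
        have h5 : H * dE (Sw T w a) (Sw T w b) ^ α ≤ |u i (Sw T w b)| * (K * q ^ w.length) := by
          calc H * dE (Sw T w a) (Sw T w b) ^ α ≤ H * (2 ^ α * q ^ w.length) := by gcongr
            _ = d * (K * q ^ w.length) := by rw [hK]; field_simp
            _ ≤ |u i (Sw T w b)| * (K * q ^ w.length) := by gcongr; exact hu i _ hb'
        have h6 := Real.add_one_le_exp (K * q ^ w.length)
        nlinarith [abs_nonneg (u i (Sw T w b))]
      rw [hcons, hcons, abs_mul, abs_mul, List.length_cons, Finset.sum_range_succ, mul_add,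
        Real.exp_add]
      calc |u i (Sw T w a)| * |U w a|
          ≤ (|u i (Sw T w b)| * Real.exp (K * q ^ w.length)) *
            (Real.exp (K * ∑ k ∈ Finset.range w.length, q ^ k) * |U w b|) := by gcongr
        _ = _ := by ring
  refine ⟨Real.exp (K * (1 - q)⁻¹), Real.one_le_exp (mul_nonneg hK0 (inv_nonneg.mpr (by linarith))),
    fun w a ha b hb => (main w a ha b hb).trans ?_⟩
  gcongr
  rw [← tsum_geometric_of_lt_one hq0 hq1]
  exact (summable_geometric_of_lt_one hq0 hq1).sum_le_tsum _ (fun k _ => pow_nonneg hq0 k)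

lemma exists_distortion (T : System I) : ∃ C : ℝ, 1 ≤ C ∧ ∀ w, ∀ a ∈ sq, ∀ b ∈ sq,
    |fxw T w a| ≤ C * |fxw T w b| ∧ |gyw T w a| ≤ C * |gyw T w b| := by
  obtain ⟨d, hd, hgd⟩ := exists_le_abs_gy T
  obtain ⟨α, hα, H, hH, hol⟩ := T.holder
  obtain ⟨C₁, h1, h1'⟩ := exists_distortion_of_cocycle T (u := fun i a => T.fx i a.1)
    (U := fxw T) (fun _ => rfl) (fun _ _ _ => rfl) hd hH hα
    (fun i a ha => (hgd i a ha).trans (abs_gy_lt_abs_fx T i ha ha.1).le)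
    (fun i a ha b hb => ((hol i).1 _ ha.1 _ hb.1).trans (by
      gcongr
      exact abs_fst_sub_le_dE a b))
  obtain ⟨C₂, h2, h2'⟩ := exists_distortion_of_cocycle T (u := T.gy)
    (U := gyw T) (fun _ => rfl) (fun _ _ _ => rfl) hd hH hα hgd (fun i => (hol i).2.2)
  refine ⟨max C₁ C₂, h1.trans (le_max_left _ _), fun w a ha b hb => ⟨?_, ?_⟩⟩
  · exact (h1' w a ha b hb).trans (mul_le_mul_of_nonneg_right (le_max_left _ _) (abs_nonneg _))
  · exact (h2' w a ha b hb).trans (mul_le_mul_of_nonneg_right (le_max_right _ _) (abs_nonneg _))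

lemma fxw_ne_zero (T : System I) (w : List I) {a : ℝ × ℝ} (ha : a ∈ sq) : fxw T w a ≠ 0 := by
  induction w with
  | nil => exact one_ne_zero
  | cons i w ih =>
    refine mul_ne_zero (abs_pos.mp ?_) ih
    have hm := Sw_mem T w ha
    exact (abs_nonneg _).trans_lt (abs_gy_lt_abs_fx T i hm hm.1)

lemma gyw_ne_zero (T : System I) (w : List I) {a : ℝ × ℝ} (ha : a ∈ sq) : gyw T w a ≠ 0 := by
  obtain ⟨d, hd, hgd⟩ := exists_le_abs_gy T
  induction w with
  | nil => exact one_ne_zero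
  | cons i w ih => exact mul_ne_zero (abs_pos.mp (hd.trans_le (hgd i _ (Sw_mem T w ha)))) ih

lemma abs_gyw_le_one (T : System I) (w : List I) {a : ℝ × ℝ} (ha : a ∈ sq) :
    |gyw T w a| ≤ 1 := by
  induction w with
  | nil => simp [gyw]
  | cons i w ih =>
    rw [gyw, abs_mul]
    exact mul_le_one₀ (abs_gy_le_one T i (Sw_mem T w ha)) (abs_nonneg _) ih

lemma exists_abs_gyw_le (T : System I) : ∃ η : ℝ, 0 < η ∧ η < 1 ∧ ∀ w : List I, ∀ a ∈ sq,
    |gyw T w a| ≤ η ^ w.length * |fxw T w a| := by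
  obtain ⟨η, h0, h1, h⟩ := exists_domination_ratio T
  refine ⟨η, h0, h1, fun w a ha => ?_⟩
  induction w with
  | nil => simp [gyw, fxw]
  | cons i w ih =>
    have hm := Sw_mem T w ha
    rw [gyw, fxw, abs_mul, abs_mul, List.length_cons]
    calc |T.gy i (Sw T w a)| * |gyw T w a|
        ≤ (η * |T.fx i (Sw T w a).1|) * (η ^ w.length * |fxw T w a|) := by
          gcongr
          exact h i _ hm _ hm.1
      _ = _ := by ring

/-- The iterated images of the square have uniformly bounded slope. -/
lemma exists_abs_gxw_le (T : System I) : ∃ M : ℝ, 0 ≤ M ∧ ∀ w : List I, ∀ a ∈ sq,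
    |gxw T w a| ≤ M * |fxw T w a| := by
  obtain ⟨η, h0, h1, h⟩ := exists_domination_ratio T
  obtain ⟨d, hd, hgd⟩ := exists_le_abs_gy T
  obtain ⟨α, hα, H, hH, hol⟩ := T.holder
  set G := ∑ i, (|T.gx i (0, 0)| + H * 2 ^ α) with hG
  have hG0 : 0 ≤ G := Finset.sum_nonneg fun i _ => by positivity
  have hgx : ∀ i, ∀ a ∈ sq, |T.gx i a| ≤ G := fun i a ha =>
    (abs_le_of_holder hH hα (hol i).2.1 ha).trans
      (Finset.single_le_sum (f := fun i => |T.gx i (0, 0)| + H * 2 ^ α)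
        (fun i _ => by positivity) (Finset.mem_univ i))
  set M := G / d / (1 - η) with hM
  have hη : 0 < 1 - η := by linarith
  have hM0 : 0 ≤ M := by positivity
  have hMeq : G / d + η * M = M := by
    rw [hM]; field_simp; ring
  refine ⟨M, hM0, fun w a ha => ?_⟩
  induction w with
  | nil => simp [gxw, fxw, hM0]
  | cons i w ih =>
    have hm := Sw_mem T w ha
    have hfx : d ≤ |T.fx i (Sw T w a).1| :=
      (hgd i _ hm).trans (abs_gy_lt_abs_fx T i hm hm.1).le
    have hgx' : |T.gx i (Sw T w a)| ≤ G / d * |T.fx i (Sw T w a).1| := by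
      calc |T.gx i (Sw T w a)| ≤ G / d * d := by
            rw [div_mul_cancel₀ _ hd.ne']; exact hgx i _ hm
        _ ≤ _ := by gcongr
    rw [gxw, fxw, abs_mul]
    calc |T.gx i (Sw T w a) * fxw T w a + T.gy i (Sw T w a) * gxw T w a|
        ≤ |T.gx i (Sw T w a)| * |fxw T w a| + |T.gy i (Sw T w a)| * |gxw T w a| := by
          rw [← abs_mul, ← abs_mul]; exact abs_add_le _ _
      _ ≤ (G / d * |T.fx i (Sw T w a).1|) * |fxw T w a| +
          (η * |T.fx i (Sw T w a).1|) * (M * |fxw T w a|) := by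
          gcongr
          exact h i _ hm _ hm.1
      _ = (G / d + η * M) * (|T.fx i (Sw T w a).1| * |fxw T w a|) := by ring
      _ = _ := by rw [hMeq]

/-! ### Singular values -/

lemma singular_values_bounds {p x g M : ℝ} (hM : 0 ≤ M) (hx : |x| ≤ M * |p|) (hg : |g| ≤ |p|) :
    |p| / 2 ≤ sv1 !![p, 0; x, g] ∧ sv1 !![p, 0; x, g] ≤ (2 + M) * |p| ∧
      sv1 !![p, 0; x, g] * sv2 !![p, 0; x, g] = |p| * |g| := by
  have hfrob : frobSq !![p, 0; x, g] = p ^ 2 + x ^ 2 + g ^ 2 := by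
    simp [frobSq, Fin.sum_univ_two]; ring
  have hdet : (!![p, 0; x, g] : Matrix (Fin 2) (Fin 2) ℝ).det = p * g := by
    simp [Matrix.det_fin_two]
  unfold sv1 sv2
  rw [hfrob, hdet]
  set N := p ^ 2 + x ^ 2 + g ^ 2 with hN
  have hN0 : 0 ≤ N := by positivity
  have hdisc : 0 ≤ N ^ 2 - 4 * (p * g) ^ 2 := by
    have h1 : 2 * |p * g| ≤ N := by
      rw [abs_mul]
      nlinarith [sq_nonneg (|p| - |g|), sq_abs p, sq_abs g, sq_nonneg x]
    nlinarith [abs_nonneg (p * g), sq_abs (p * g)]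
  set R := Real.sqrt (N ^ 2 - 4 * (p * g) ^ 2) with hR
  have hR0 : 0 ≤ R := Real.sqrt_nonneg _
  have hRsq : R ^ 2 = N ^ 2 - 4 * (p * g) ^ 2 := Real.sq_sqrt hdisc
  have hRN : R ≤ N := by nlinarith [sq_nonneg (p * g)]
  have hxs : x ^ 2 ≤ M ^ 2 * p ^ 2 := by
    rw [← sq_abs x, ← sq_abs p, ← mul_pow]; gcongr
  have hgs : g ^ 2 ≤ p ^ 2 := sq_le_sq.mpr hg
  refine ⟨?_, ?_, ?_⟩
  · apply Real.le_sqrt_of_sq_le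
    rw [div_pow, sq_abs]
    nlinarith [sq_nonneg x, sq_nonneg g, sq_nonneg p]
  · rw [Real.sqrt_le_iff]
    refine ⟨by positivity, ?_⟩
    rw [mul_pow, sq_abs]
    nlinarith [sq_nonneg p, mul_nonneg hM (sq_nonneg p)]
  · rw [← Real.sqrt_mul (by linarith), ← abs_mul, ← Real.sqrt_sq_eq_abs]
    congr 1
    nlinarith

/-- Up to bounded errors the logarithms of the singular values are those of the diagonal entries. -/
lemma exists_abs_log_alpha_sub_le (T : System I) : ∃ K : ℝ, ∀ w : List I, ∀ a ∈ sq,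
    |Real.log (alpha1 T w a) - Real.log (|fxw T w a|)| ≤ K ∧
    |Real.log (alpha2 T w a) - Real.log (|gyw T w a|)| ≤ K := by
  obtain ⟨M, hM, hslope⟩ := exists_abs_gxw_le T
  obtain ⟨η, h0, h1, hη⟩ := exists_abs_gyw_le T
  refine ⟨Real.log (2 + M), fun w a ha => ?_⟩
  have hf : 0 < |fxw T w a| := abs_pos.mpr (fxw_ne_zero T w ha)
  have hg : 0 < |gyw T w a| := abs_pos.mpr (gyw_ne_zero T w ha)
  have hgf : |gyw T w a| ≤ |fxw T w a| :=
    (hη w a ha).trans (mul_le_of_le_one_left hf.le (pow_le_one₀ h0.le h1.le))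
  obtain ⟨hl, hu, hp⟩ := singular_values_bounds hM (hslope w a ha) hgf
  have ha1 : 0 < sv1 !![fxw T w a, 0; gxw T w a, gyw T w a] := by linarith
  have ha2 : 0 < sv2 !![fxw T w a, 0; gxw T w a, gyw T w a] := by
    by_contra hneg
    have := mul_nonpos_of_nonneg_of_nonpos ha1.le (not_lt.mp hneg)
    rw [hp] at this
    exact absurd this (not_le.mpr (mul_pos hf hg))
  have hlp := congrArg Real.log hp
  rw [Real.log_mul ha1.ne' ha2.ne', Real.log_mul hf.ne' hg.ne'] at hlp
  have hll := Real.log_le_log (by linarith) hl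
  have hlu := Real.log_le_log ha1 hu
  rw [Real.log_div hf.ne' two_ne_zero] at hll
  rw [Real.log_mul (by linarith) hf.ne'] at hlu
  have h2M : Real.log 2 ≤ Real.log (2 + M) := Real.log_le_log two_pos (by linarith)
  unfold alpha1 alpha2 Dmat
  constructor <;> rw [abs_le] <;> constructor <;> linarith

end

section

variable {I : Type} [Fintype I]

/-! ### Geometry of the iterated images of the square -/

lemma exists_Sw_slopes (T : System I) (w : List I) {y z : ℝ × ℝ} (hy : y ∈ sq) (hz : z ∈ sq) :
    (∃ b ∈ sq, (Sw T w y).1 - (Sw T w z).1 = fxw T w b * (y.1 - z.1)) ∧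
    ∃ b ∈ sq, ∃ b' ∈ sq,
      (Sw T w y).2 - (Sw T w z).2 = gxw T w b * (y.1 - z.1) + gyw T w b' * (y.2 - z.2) := by
  obtain ⟨ξ₁, h₁, e₁⟩ := exists_eq_slope
    (fun x hx => hasDerivWithinAt_Sw_fst T w hy.2 hx) hz.1 hy.1
  obtain ⟨ξ₂, h₂, e₂⟩ := exists_eq_slope
    (fun x hx => hasDerivWithinAt_horizontal T w hy.2 hx) hz.1 hy.1
  obtain ⟨ξ₃, h₃, e₃⟩ := exists_eq_slope
    (fun s hs => hasDerivWithinAt_vertical T w hz.1 hs) hz.2 hy.2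
  refine ⟨⟨(ξ₁, y.2), ⟨h₁, hy.2⟩, ?_⟩, (ξ₂, y.2), ⟨h₂, hy.2⟩, (z.1, ξ₃), ⟨hz.1, h₃⟩, ?_⟩
  · rw [← e₁]
    congr 1
    exact Sw_fst T w rfl
  · rw [← e₂, ← e₃]
    ring

/-- Two points whose first coordinates are close are mapped by `S_w` to points at distance
comparable to the smaller singular value. -/
lemma exists_dE_Sw_le_mul_gyw (T : System I) : ∃ C : ℝ, 0 < C ∧ ∀ w : List I, ∀ y ∈ sq, ∀ z ∈ sq,
    |y.1 - z.1| * |fxw T w y| ≤ |gyw T w y| → dE (Sw T w y) (Sw T w z) ≤ C * |gyw T w y| := by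
  obtain ⟨C, hC1, hC⟩ := exists_distortion T
  obtain ⟨M, hM, hslope⟩ := exists_abs_gxw_le T
  refine ⟨C + M * C + C, by positivity, fun w y hy z hz h => ?_⟩
  obtain ⟨⟨b₁, hb₁, e₁⟩, b₂, hb₂, b₃, hb₃, e₂⟩ := exists_Sw_slopes T w hy hz
  have hB : |y.2 - z.2| ≤ 1 := by
    rw [abs_le]; constructor <;> linarith [hy.2.1, hy.2.2, hz.2.1, hz.2.2]
  have h1 : |fxw T w b₁ * (y.1 - z.1)| ≤ C * |gyw T w y| := by
    rw [abs_mul]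
    calc |fxw T w b₁| * |y.1 - z.1| ≤ (C * |fxw T w y|) * |y.1 - z.1| := by
          gcongr; exact (hC w b₁ hb₁ y hy).1
      _ = C * (|y.1 - z.1| * |fxw T w y|) := by ring
      _ ≤ _ := by gcongr
  have h2 : |gxw T w b₂ * (y.1 - z.1)| ≤ M * C * |gyw T w y| := by
    rw [abs_mul]
    calc |gxw T w b₂| * |y.1 - z.1| ≤ (M * (C * |fxw T w y|)) * |y.1 - z.1| := by
          gcongr
          exact (hslope w b₂ hb₂).trans (mul_le_mul_of_nonneg_left (hC w b₂ hb₂ y hy).1 hM)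
      _ = M * C * (|y.1 - z.1| * |fxw T w y|) := by ring
      _ ≤ _ := by gcongr
  have h3 : |gyw T w b₃ * (y.2 - z.2)| ≤ C * |gyw T w y| := by
    rw [abs_mul]
    calc |gyw T w b₃| * |y.2 - z.2| ≤ (C * |gyw T w y|) * 1 := by
          gcongr; exact (hC w b₃ hb₃ y hy).2
      _ = _ := mul_one _
  have h4 := dE_le_add (Sw T w y) (Sw T w z)
  rw [e₁, e₂] at h4
  have h5 := abs_add_le (gxw T w b₂ * (y.1 - z.1)) (gyw T w b₃ * (y.2 - z.2))
  linarith

lemma exists_fst_sub_mul_le_dE (T : System I) : ∃ C : ℝ, 0 < C ∧ ∀ w : List I,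
    ∀ y ∈ sq, ∀ z ∈ sq, |y.1 - z.1| * |fxw T w y| ≤ C * dE (Sw T w y) (Sw T w z) := by
  obtain ⟨C, hC1, hC⟩ := exists_distortion T
  refine ⟨C, by positivity, fun w y hy z hz => ?_⟩
  obtain ⟨⟨b₁, hb₁, e₁⟩, -⟩ := exists_Sw_slopes T w hy hz
  have h := abs_fst_sub_le_dE (Sw T w y) (Sw T w z)
  rw [e₁, abs_mul] at h
  calc |y.1 - z.1| * |fxw T w y| ≤ |y.1 - z.1| * (C * |fxw T w b₁|) := by
        gcongr; exact (hC w y hy b₁ hb₁).1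
    _ = C * (|fxw T w b₁| * |y.1 - z.1|) := by ring
    _ ≤ _ := by gcongr

/-- Distances are contracted by `S_w` at most by the smaller singular value. -/
lemma exists_mul_gyw_le_dE_Sw (T : System I) : ∃ κ : ℝ, 0 < κ ∧ ∀ w : List I, ∀ y ∈ sq, ∀ z ∈ sq,
    κ * (|gyw T w y| * dE y z) ≤ dE (Sw T w y) (Sw T w z) := by
  obtain ⟨C, hC1, hC⟩ := exists_distortion T
  obtain ⟨M, hM, hslope⟩ := exists_abs_gxw_le T
  obtain ⟨C', hC'0, hC'⟩ := exists_fst_sub_mul_le_dE T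
  obtain ⟨η, h0, h1, hη⟩ := exists_abs_gyw_le T
  set Q := C' + C * (1 + M * C * C') with hQ
  have hQ0 : 0 < Q := by positivity
  refine ⟨Q⁻¹, by positivity, fun w y hy z hz => ?_⟩
  obtain ⟨-, b₂, hb₂, b₃, hb₃, e₂⟩ := exists_Sw_slopes T w hy hz
  set D := dE (Sw T w y) (Sw T w z) with hD
  have hgf : |gyw T w y| ≤ |fxw T w y| :=
    (hη w y hy).trans (mul_le_of_le_one_left (abs_nonneg _) (pow_le_one₀ h0.le h1.le))
  have hA := hC' w y hy z hz
  have hV := abs_snd_sub_le_dE (Sw T w y) (Sw T w z)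
  rw [e₂] at hV
  have hX : |gxw T w b₂ * (y.1 - z.1)| ≤ M * C * (C' * D) := by
    rw [abs_mul]
    calc |gxw T w b₂| * |y.1 - z.1| ≤ (M * (C * |fxw T w y|)) * |y.1 - z.1| := by
          gcongr
          exact (hslope w b₂ hb₂).trans (mul_le_mul_of_nonneg_left (hC w b₂ hb₂ y hy).1 hM)
      _ = M * C * (|y.1 - z.1| * |fxw T w y|) := by ring
      _ ≤ _ := by gcongr
  have hY : |gyw T w y| * |y.2 - z.2| ≤ C * ((1 + M * C * C') * D) := by
    calc |gyw T w y| * |y.2 - z.2| ≤ (C * |gyw T w b₃|) * |y.2 - z.2| := by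
          gcongr; exact (hC w y hy b₃ hb₃).2
      _ = C * |gyw T w b₃ * (y.2 - z.2)| := by rw [abs_mul]; ring
      _ ≤ C * ((1 + M * C * C') * D) := by
          gcongr
          have := abs_sub_abs_le_abs_sub (gyw T w b₃ * (y.2 - z.2)) (-(gxw T w b₂ * (y.1 - z.1)))
          rw [sub_neg_eq_add, abs_neg, add_comm (gyw T w b₃ * _)] at this
          linarith
  have hG : |gyw T w y| * |y.1 - z.1| ≤ C' * D := by
    refine le_trans ?_ hA
    rw [mul_comm]
    gcongr
  rw [inv_mul_le_iff₀ hQ0]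
  calc |gyw T w y| * dE y z ≤ |gyw T w y| * (|y.1 - z.1| + |y.2 - z.2|) := by
        gcongr; exact dE_le_add y z
    _ ≤ Q * D := by rw [hQ]; linarith

/-! ### Words and cylinders -/

section Words

variable {I : Type}

lemma shiftn_shiftn (ii : ℕ → I) (n k : ℕ) : shiftn (shiftn ii n) k = shiftn ii (n + k) := by
  funext j; simp only [shiftn]; congr 1; omega

lemma word_length (ii : ℕ → I) (n : ℕ) : (word ii n).length = n := by simp [word]

lemma mem_cyl {w : List I} {jj : ℕ → I} :
    jj ∈ cyl w ↔ ∀ k (hk : k < w.length), jj k = w[k] :=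
  ⟨fun h k hk => h ⟨k, hk⟩, fun h k => h k.1 k.2⟩

lemma mem_cyl_word {ii jj : ℕ → I} {n : ℕ} : jj ∈ cyl (word ii n) ↔ ∀ k < n, jj k = ii k := by
  simp [mem_cyl, word]

lemma word_eq_of_mem_cyl {ii jj : ℕ → I} {n : ℕ} (h : jj ∈ cyl (word ii n)) :
    word jj n = word ii n := by
  rw [mem_cyl_word] at h
  unfold word
  congr 1
  funext k
  exact h k.1 k.2

lemma word_add (ii : ℕ → I) (n k : ℕ) : word ii (n + k) = word ii n ++ word (shiftn ii n) k := by
  unfold word shiftn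
  rw [List.ofFn_add]
  simp [add_comm]

lemma cyl_append (ii : ℕ → I) (n : ℕ) (v : List I) :
    cyl (word ii n ++ v) = cyl (word ii n) ∩ (fun jj => shiftn jj n) ⁻¹' cyl v := by
  ext jj
  rw [mem_inter_iff, mem_cyl_word, mem_preimage, mem_cyl, mem_cyl]
  have hl : (word ii n).length = n := word_length ii n
  simp only [shiftn, List.length_append, hl]
  constructor
  · intro h
    refine ⟨fun k hk => ?_, fun k hk => ?_⟩
    · have := h k (by omega)
      rw [List.getElem_append_left (by omega)] at this
      simpa [word] using this
    · have := h (k + n) (by omega)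
      rw [List.getElem_append_right (by omega)] at this
      simpa [hl] using this
  · rintro ⟨h1, h2⟩ k hk
    by_cases hkn : k < n
    · rw [List.getElem_append_left (by omega)]
      simpa [word] using h1 k hkn
    · rw [List.getElem_append_right (by omega)]
      have := h2 (k - n) (by omega)
      simp only [hl]
      rw [← this]
      congr 1
      omega

end Words

/-! ### The coding map -/

section Coding

variable {T : System I} {F : Set (ℝ × ℝ)} {Pi : (ℕ → I) → ℝ × ℝ}

lemma coding_mem_sq (hPi : IsCoding T Pi) (ii : ℕ → I) : Pi ii ∈ sq := by
  obtain ⟨a, ha, h⟩ := hPi ii 0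
  rw [← h]
  exact Sw_mem T _ ha

lemma tendsto_two_mul_pow {c : ℝ} (h0 : 0 ≤ c) (h1 : c < 1) :
    Tendsto (fun n : ℕ => 2 * c ^ n) atTop (nhds 0) := by
  simpa using (tendsto_pow_atTop_nhds_zero_of_lt_one h0 h1).const_mul 2

lemma eq_of_dE_le {a b : ℝ × ℝ} {u : ℕ → ℝ} (hu : Tendsto u atTop (nhds 0))
    (h : ∀ n, dE a b ≤ u n) : a = b := by
  have h0 : dE a b ≤ 0 := ge_of_tendsto' hu h
  exact dist_le_zero.mp ((dist_le_dE a b).trans h0)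

lemma coding_eq_Sw (hPi : IsCoding T Pi) (ii : ℕ → I) (n : ℕ) :
    Pi ii = Sw T (word ii n) (Pi (shiftn ii n)) := by
  obtain ⟨c, h0, h1, hc⟩ := dE_Sw_le T
  refine eq_of_dE_le (u := fun k => 2 * c ^ (n + k))
    ((tendsto_two_mul_pow h0 h1).comp (tendsto_add_atTop_nat n |>.congr fun k => add_comm k n))
    fun k => ?_
  obtain ⟨a, ha, ea⟩ := hPi ii (n + k)
  obtain ⟨b, hb, eb⟩ := hPi (shiftn ii n) k
  have h := hc (word ii (n + k)) a ha b hb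
  rw [word_length, ea, word_add, Sw_append, eb] at h
  exact h

lemma dE_coding_le (hPi : IsCoding T Pi) : ∃ c : ℝ, 0 ≤ c ∧ c < 1 ∧ ∀ ii n,
    ∀ jj ∈ cyl (word ii n), dE (Pi ii) (Pi jj) ≤ 2 * c ^ n := by
  obtain ⟨c, h0, h1, hc⟩ := dE_Sw_le T
  refine ⟨c, h0, h1, fun ii n jj hj => ?_⟩
  rw [coding_eq_Sw hPi ii n, coding_eq_Sw hPi jj n, word_eq_of_mem_cyl hj]
  simpa only [word_length] using
    hc (word ii n) _ (coding_mem_sq hPi (shiftn ii n)) _ (coding_mem_sq hPi (shiftn jj n))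

lemma Sw_mem_attractor (hF : IsAttractor T F) (w : List I) {a : ℝ × ℝ} (ha : a ∈ F) :
    Sw T w a ∈ F := by
  induction w with
  | nil => exact ha
  | cons i w ih =>
    rw [hF.2.2.2]
    exact mem_iUnion.mpr ⟨i, mem_image_of_mem _ ih⟩

lemma coding_mem_attractor (hPi : IsCoding T Pi) (hF : IsAttractor T F) (ii : ℕ → I) :
    Pi ii ∈ F := by
  obtain ⟨c, h0, h1, hc⟩ := dE_Sw_le T
  obtain ⟨p, hp⟩ := hF.1
  have hlim : Tendsto (fun n => Sw T (word ii n) p) atTop (nhds (Pi ii)) := by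
    rw [tendsto_iff_dist_tendsto_zero]
    refine squeeze_zero (fun _ => dist_nonneg) (fun n => ?_) (tendsto_two_mul_pow h0 h1)
    rw [coding_eq_Sw hPi ii n]
    have h := hc (word ii n) p (hF.2.2.1 hp) _ (coding_mem_sq hPi (shiftn ii n))
    rw [word_length] at h
    exact (dist_le_dE _ _).trans h
  exact hF.2.1.isClosed.mem_of_tendsto hlim
    (Eventually.of_forall fun n => Sw_mem_attractor hF _ hp)

lemma coding_mem_image (hPi : IsCoding T Pi) (hF : IsAttractor T F) (ii : ℕ → I) :
    Pi ii ∈ S T (ii 0) '' F := by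
  have h := coding_eq_Sw hPi ii 1
  refine ⟨Pi (shiftn ii 1), coding_mem_attractor hPi hF _, ?_⟩
  rw [h]
  simp [word, Sw]

lemma isCompact_image_S (hF : IsAttractor T F) (i : I) : IsCompact (S T i '' F) := by
  refine hF.2.1.image_of_continuousOn ?_
  have h1 : ContinuousOn (fun a : ℝ × ℝ => T.f i a.1) F := by
    have hf : ContinuousOn (T.f i) (Icc 0 1) := fun x hx => (T.hasDeriv_f i x hx).continuousWithinAt
    exact hf.comp continuousOn_fst fun a ha => (hF.2.2.1 ha).1
  have h2 : ContinuousOn (T.g i) F := fun a ha =>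
    ((T.hasDeriv_g i a (hF.2.2.1 ha)).continuousWithinAt).mono hF.2.2.1
  exact h1.prodMk h2

lemma exists_separation (hPi : IsCoding T Pi) (hF : IsAttractor T F) (hSSC : SSC T F) :
    ∃ δ : ℝ, 0 < δ ∧ ∀ ii jj : ℕ → I, ii 0 ≠ jj 0 → δ ≤ dE (Pi ii) (Pi jj) := by
  have key : ∀ p : I × I, ∃ δ : ℝ, 0 < δ ∧ (p.1 ≠ p.2 → ∀ a ∈ S T p.1 '' F,
      ∀ b ∈ S T p.2 '' F, δ ≤ dist a b) := by
    rintro ⟨i, j⟩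
    by_cases hij : i = j
    · exact ⟨1, one_pos, fun h => absurd hij h⟩
    · obtain ⟨r, hr, h⟩ := Metric.exists_pos_forall_lt_edist (isCompact_image_S hF i)
        (isCompact_image_S hF j).isClosed (hSSC i j hij)
      refine ⟨r, by exact_mod_cast hr, fun _ a ha b hb => ?_⟩
      have := h a ha b hb
      rw [edist_nndist] at this
      exact_mod_cast this.le
  choose δ hδ0 hδ using key
  have : Nonempty I := Fintype.card_pos_iff.mp (by have := T.card2; omega)
  obtain ⟨p₀, hp₀⟩ := Finite.exists_min δ
  exact ⟨δ p₀, hδ0 p₀, fun ii jj h => (hp₀ (ii 0, jj 0)).trans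
    ((hδ (ii 0, jj 0) h _ (coding_mem_image hPi hF ii) _ (coding_mem_image hPi hF jj)).trans
      (dist_le_dE _ _))⟩

/-- A point of the attractor close to `Π(i)` at the scale of the smaller singular value of
`S_{i|n}` has a coding that starts with `i|n`. -/
lemma exists_mem_cyl_of_dE_lt (hPi : IsCoding T Pi) (hF : IsAttractor T F) (hSSC : SSC T F) :
    ∃ κ : ℝ, 0 < κ ∧ ∀ ii jj : ℕ → I, ∀ n,
      dE (Pi ii) (Pi jj) < κ * |gyw T (word ii n) (Pi (shiftn ii n))| →
        jj ∈ cyl (word ii n) := by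
  obtain ⟨δ, hδ, hsep⟩ := exists_separation hPi hF hSSC
  obtain ⟨κ, hκ, h⟩ := exists_mul_gyw_le_dE_Sw T
  refine ⟨κ * δ, by positivity, fun ii jj n hlt => ?_⟩
  by_contra hnot
  obtain ⟨k, hkn, hkne, hmin⟩ : ∃ k < n, jj k ≠ ii k ∧ ∀ l < k, jj l = ii l := by
    classical
    rw [mem_cyl_word] at hnot
    push Not at hnot
    obtain ⟨h1, h2⟩ := Nat.find_spec hnot
    refine ⟨Nat.find hnot, h1, h2, fun l hl => ?_⟩
    by_contra hne
    exact Nat.find_min hnot hl ⟨hl.trans h1, hne⟩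
  have hcyl : jj ∈ cyl (word ii k) := mem_cyl_word.mpr hmin
  have h1 := h (word ii k) _ (coding_mem_sq hPi (shiftn ii k)) _
    (coding_mem_sq hPi (shiftn jj k))
  rw [← coding_eq_Sw hPi ii k, ← word_eq_of_mem_cyl hcyl, ← coding_eq_Sw hPi jj k,
    word_eq_of_mem_cyl hcyl] at h1
  have h2 : δ ≤ dE (Pi (shiftn ii k)) (Pi (shiftn jj k)) :=
    hsep _ _ (by simpa [shiftn] using hkne.symm)
  have h3 : |gyw T (word ii n) (Pi (shiftn ii n))| ≤ |gyw T (word ii k) (Pi (shiftn ii k))| := by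
    obtain ⟨l, rfl⟩ := Nat.exists_eq_add_of_le hkn.le
    rw [word_add, gyw_append, ← shiftn_shiftn, ← coding_eq_Sw hPi (shiftn ii k) l, abs_mul]
    exact mul_le_of_le_one_right (abs_nonneg _) (abs_gyw_le_one T _ (coding_mem_sq hPi _))
  have h4 : κ * δ * |gyw T (word ii n) (Pi (shiftn ii n))| ≤ dE (Pi ii) (Pi jj) := by
    calc κ * δ * |gyw T (word ii n) (Pi (shiftn ii n))|
        = κ * (|gyw T (word ii n) (Pi (shiftn ii n))| * δ) := by ring
      _ ≤ κ * (|gyw T (word ii k) (Pi (shiftn ii k))| *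
            dE (Pi (shiftn ii k)) (Pi (shiftn jj k))) := by gcongr
      _ ≤ _ := h1
  linarith

lemma coding_injective (hPi : IsCoding T Pi) (hF : IsAttractor T F) (hSSC : SSC T F) :
    Function.Injective Pi := by
  obtain ⟨κ, hκ, h⟩ := exists_mem_cyl_of_dE_lt hPi hF hSSC
  intro ii jj hij
  funext k
  have hmem : jj ∈ cyl (word ii (k + 1)) := h ii jj (k + 1) (by
    rw [hij]
    have h0 : dE (Pi jj) (Pi jj) = 0 := by simp [dE]
    rw [h0]
    exact mul_pos hκ (abs_pos.mpr (gyw_ne_zero T _ (coding_mem_sq hPi _))))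
  exact (mem_cyl_word.mp hmem k (Nat.lt_succ_self k)).symm

end Coding

end

section

/-! ### Measures on the symbolic space -/

section Measurability

variable {I : Type} [MeasurableSpace I]

lemma measurableSet_cyl [MeasurableSingletonClass I] (w : List I) :
    MeasurableSet (cyl w : Set (ℕ → I)) := by
  have h : (cyl w : Set (ℕ → I)) = ⋂ k : Fin w.length, (fun jj : ℕ → I => jj k.1) ⁻¹' {w.get k} := by
    ext jj; simp [cyl]
  rw [h]
  exact MeasurableSet.iInter fun k => measurable_pi_apply _ (measurableSet_singleton _)

lemma measurable_shiftn (n : ℕ) : Measurable fun jj : ℕ → I => shiftn jj n :=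
  measurable_pi_lambda _ fun _ => measurable_pi_apply _

lemma map_ballE {Pi : (ℕ → I) → ℝ × ℝ} {m : Measure (ℕ → I)} (hPim : Measurable Pi)
    (x : ℝ × ℝ) (r : ℝ) :
    (m.map Pi) (ballE x r) = m {jj | dE x (Pi jj) ≤ r} :=
  Measure.map_apply hPim (isClosed_ballE x r).measurableSet

lemma map_fst_closedBall {Pi : (ℕ → I) → ℝ × ℝ} {m : Measure (ℕ → I)} (hPim : Measurable Pi)
    (x r : ℝ) :
    ((m.map Pi).map Prod.fst) (Metric.closedBall x r) = m {jj | |(Pi jj).1 - x| ≤ r} := by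
  rw [Measure.map_apply measurable_fst Metric.isClosed_closedBall.measurableSet,
    Measure.map_apply hPim (measurable_fst Metric.isClosed_closedBall.measurableSet)]
  rfl

end Measurability

section Symbolic

variable {I : Type} [Fintype I]

/-- The coding of a closed vertical strip is closed. -/
lemma mem_strip_of_forall_cyl {T : System I} {Pi : (ℕ → I) → ℝ × ℝ} (hPi : IsCoding T Pi)
    (x r : ℝ) (jj : ℕ → I)
    (h : ∀ k, ∃ jj' ∈ {jj : ℕ → I | |(Pi jj).1 - x| ≤ r}, jj' ∈ cyl (word jj k)) :
    jj ∈ {jj : ℕ → I | |(Pi jj).1 - x| ≤ r} := by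
  obtain ⟨c, h0, h1, hc⟩ := dE_coding_le hPi
  have hlim : Tendsto (fun k : ℕ => 2 * c ^ k + r) atTop (nhds (0 + r)) :=
    (tendsto_two_mul_pow h0 h1).add_const r
  rw [zero_add] at hlim
  refine ge_of_tendsto' hlim fun k => ?_
  obtain ⟨jj', h2, h3⟩ := h k
  have h4 := (abs_fst_sub_le_dE _ _).trans (hc jj k jj' h3)
  have h5 := abs_sub_le (Pi jj).1 (Pi jj').1 x
  have h6 : |(Pi jj').1 - x| ≤ r := h2
  linarith

lemma measurableSingletonClass_of_coding [MeasurableSpace I] {T : System I} {F : Set (ℝ × ℝ)}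
    {Pi : (ℕ → I) → ℝ × ℝ} (hPi : IsCoding T Pi) (hF : IsAttractor T F) (hSSC : SSC T F)
    (hPim : Measurable Pi) : MeasurableSingletonClass I := by
  refine ⟨fun i => ?_⟩
  have h1 : MeasurableSet (Pi ⁻¹' (S T i '' F)) := hPim (isCompact_image_S hF i).measurableSet
  have hc : Measurable (fun i : I => fun _ : ℕ => i) := measurable_pi_lambda _ fun _ => measurable_id
  convert hc h1
  ext j
  simp only [mem_singleton_iff, mem_preimage]
  have hj : Pi (fun _ => j) ∈ S T j '' F := coding_mem_image hPi hF fun _ => j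
  constructor
  · rintro rfl
    exact hj
  · intro h
    by_contra hne
    exact Set.disjoint_left.mp (hSSC j i hne) hj h

variable [MeasurableSpace I]

/-- The quasi-Bernoulli property extends from cylinders to closed sets. -/
lemma QuasiBernoulli.measure_inter [MeasurableSingletonClass I] {m : Measure (ℕ → I)}
    [IsProbabilityMeasure m] {L : ℝ} (hQB : QuasiBernoulli m L) {A : Set (ℕ → I)}
    (hA : ∀ jj, (∀ k, ∃ jj' ∈ A, jj' ∈ cyl (word jj k)) → jj ∈ A) (ii : ℕ → I) (n : ℕ) :
    L⁻¹ * (m (cyl (word ii n))).toReal * (m A).toReal ≤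
        (m (cyl (word ii n) ∩ (fun jj => shiftn jj n) ⁻¹' A)).toReal ∧
      (m (cyl (word ii n) ∩ (fun jj => shiftn jj n) ⁻¹' A)).toReal ≤
        L * (m (cyl (word ii n))).toReal * (m A).toReal := by
  classical
  set W : ∀ k : ℕ, Finset (Fin k → I) := fun k =>
    Finset.univ.filter fun v => ∃ jj ∈ A, ∀ l : Fin k, jj l = v l with hW
  set Ak : ℕ → Set (ℕ → I) := fun k => ⋃ v ∈ W k, cyl (List.ofFn v) with hAk
  have mem_cyl_ofFn : ∀ {k : ℕ} {v : Fin k → I} {jj : ℕ → I},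
      jj ∈ cyl (List.ofFn v) ↔ ∀ l : Fin k, jj l = v l := by
    intro k v jj
    rw [mem_cyl]
    simp only [List.getElem_ofFn, List.length_ofFn]
    exact ⟨fun h l => h l.1 l.2, fun h l hl => h ⟨l, hl⟩⟩
  have mem_Ak : ∀ {k jj}, jj ∈ Ak k ↔ ∃ jj' ∈ A, jj' ∈ cyl (word jj k) := by
    intro k jj
    simp only [hAk, mem_iUnion, hW, Finset.mem_filter, Finset.mem_univ, true_and, exists_prop,
      mem_cyl_ofFn, mem_cyl_word]
    constructor
    · rintro ⟨v, ⟨jj', h1, h2⟩, h3⟩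
      exact ⟨jj', h1, fun l hl => (h2 ⟨l, hl⟩).trans (h3 ⟨l, hl⟩).symm⟩
    · rintro ⟨jj', h1, h2⟩
      exact ⟨fun l => jj l, ⟨jj', h1, fun l => h2 l l.2⟩, fun l => rfl⟩
  have hmeas : ∀ k, MeasurableSet (Ak k) := fun k =>
    Finset.measurableSet_biUnion _ fun v _ => measurableSet_cyl _
  have hanti : Antitone Ak := by
    intro k l hkl jj hjj
    rw [mem_Ak] at hjj ⊢
    obtain ⟨jj', h1, h2⟩ := hjj
    exact ⟨jj', h1, mem_cyl_word.mpr fun a ha => mem_cyl_word.mp h2 a (by omega)⟩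
  have hinter : ⋂ k, Ak k = A := by
    apply Subset.antisymm
    · intro jj hjj
      exact hA jj fun k => mem_Ak.mp (mem_iInter.mp hjj k)
    · intro jj hjj
      exact mem_iInter.mpr fun k => mem_Ak.mpr ⟨jj, hjj, mem_cyl_word.mpr fun _ _ => rfl⟩
  have hdisj : ∀ k, (W k : Set (Fin k → I)).PairwiseDisjoint fun v => (cyl (List.ofFn v) : Set (ℕ → I)) := by
    intro k v _ v' _ hne
    rw [Function.onFun, Set.disjoint_left]
    intro jj h1 h2
    rw [mem_cyl_ofFn] at h1 h2
    exact hne (funext fun l => (h1 l).symm.trans (h2 l))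
  set B : ℕ → Set (ℕ → I) := fun k => cyl (word ii n) ∩ (fun jj => shiftn jj n) ⁻¹' Ak k with hB
  have hBmeas : ∀ k, MeasurableSet (B k) := fun k =>
    (measurableSet_cyl _).inter (measurable_shiftn n (hmeas k))
  have hBanti : Antitone B := fun k l hkl =>
    inter_subset_inter_right _ (preimage_mono (hanti hkl))
  have hBinter : ⋂ k, B k = cyl (word ii n) ∩ (fun jj => shiftn jj n) ⁻¹' A := by
    rw [← hinter, preimage_iInter, inter_iInter]
  have hsumA : ∀ k, m.real (Ak k) = ∑ v ∈ W k, m.real (cyl (List.ofFn v)) := fun k =>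
    measureReal_biUnion_finset (hdisj k) fun v _ => measurableSet_cyl _
  have hBeq : ∀ k, B k = ⋃ v ∈ W k, cyl (word ii n ++ List.ofFn v) := by
    intro k
    simp only [hB, hAk, preimage_iUnion, inter_iUnion, cyl_append]
  have hsumB : ∀ k, m.real (B k) = ∑ v ∈ W k, m.real (cyl (word ii n ++ List.ofFn v)) := by
    intro k
    rw [hBeq]
    refine measureReal_biUnion_finset ?_ fun v _ => measurableSet_cyl _
    intro v hv v' hv' hne
    rw [Function.onFun, cyl_append, cyl_append]
    exact ((hdisj k hv hv' hne).preimage _).mono inter_subset_right inter_subset_right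
  have hlim : ∀ {D : ℕ → Set (ℕ → I)}, (∀ k, MeasurableSet (D k)) → Antitone D →
      Tendsto (fun k => m.real (D k)) atTop (nhds (m.real (⋂ k, D k))) := fun hD hDa =>
    (ENNReal.tendsto_toReal (measure_ne_top _ _)).comp
      (tendsto_measure_iInter_atTop (fun k => (hD k).nullMeasurableSet) hDa
        ⟨0, measure_ne_top _ _⟩)
  have hlimA := hlim hmeas hanti
  have hlimB := hlim hBmeas hBanti
  rw [hinter] at hlimA
  rw [hBinter] at hlimB
  constructor
  · refine le_of_tendsto_of_tendsto' (hlimA.const_mul (L⁻¹ * m.real (cyl (word ii n)))) hlimB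
      fun k => ?_
    rw [hsumA, hsumB, Finset.mul_sum]
    exact Finset.sum_le_sum fun v _ => (hQB.2 _ _).1
  · refine le_of_tendsto_of_tendsto' hlimB (hlimA.const_mul (L * m.real (cyl (word ii n))))
      fun k => ?_
    rw [hsumA, hsumB, Finset.mul_sum]
    exact Finset.sum_le_sum fun v _ => (hQB.2 _ _).2

variable {T : System I} {F : Set (ℝ × ℝ)} {Pi : (ℕ → I) → ℝ × ℝ} {m : Measure (ℕ → I)}

variable [MeasurableSingletonClass I] [IsProbabilityMeasure m]

lemma exists_le_measure_ballE (hPi : IsCoding T Pi) (hPim : Measurable Pi) {L : ℝ}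
    (hQB : QuasiBernoulli m L) : ∃ C : ℝ, 0 < C ∧ ∀ (ii : ℕ → I) (n : ℕ),
      L⁻¹ * (m (cyl (word ii n))).toReal *
        (((m.map Pi).map Prod.fst) (Metric.closedBall (Pi (shiftn ii n)).1
          (|gyw T (word ii n) (Pi (shiftn ii n))| /
            |fxw T (word ii n) (Pi (shiftn ii n))|))).toReal ≤
      ((m.map Pi) (ballE (Pi ii) (C * |gyw T (word ii n) (Pi (shiftn ii n))|))).toReal := by
  obtain ⟨C, hC, h⟩ := exists_dE_Sw_le_mul_gyw T
  refine ⟨C, hC, fun ii n => ?_⟩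
  rw [map_fst_closedBall hPim, map_ballE hPim]
  refine (hQB.measure_inter (mem_strip_of_forall_cyl hPi _ _) ii n).1.trans ?_
  refine ENNReal.toReal_mono (measure_ne_top _ _) (measure_mono ?_)
  rintro jj ⟨h1, h2⟩
  have h2' : |(Pi (shiftn jj n)).1 - (Pi (shiftn ii n)).1| ≤ _ := h2
  have hf := abs_pos.mpr (fxw_ne_zero T (word ii n) (coding_mem_sq hPi (shiftn ii n)))
  rw [le_div_iff₀ hf, abs_sub_comm] at h2'
  have h3 := h (word ii n) _ (coding_mem_sq hPi _) _ (coding_mem_sq hPi _) h2'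
  rwa [← coding_eq_Sw hPi, ← word_eq_of_mem_cyl h1, ← coding_eq_Sw hPi,
    word_eq_of_mem_cyl h1] at h3

lemma exists_measure_ballE_le (hPi : IsCoding T Pi) (hF : IsAttractor T F) (hSSC : SSC T F)
    (hPim : Measurable Pi) {L : ℝ} (hQB : QuasiBernoulli m L) :
    ∃ κ : ℝ, 0 < κ ∧ ∃ C : ℝ, 0 < C ∧ ∀ (ii : ℕ → I) (n : ℕ),
      ((m.map Pi) (ballE (Pi ii) (κ * |gyw T (word ii n) (Pi (shiftn ii n))|))).toReal ≤
      L * (m (cyl (word ii n))).toReal *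
        (((m.map Pi).map Prod.fst) (Metric.closedBall (Pi (shiftn ii n)).1
          (C * (|gyw T (word ii n) (Pi (shiftn ii n))| /
            |fxw T (word ii n) (Pi (shiftn ii n))|)))).toReal := by
  obtain ⟨κ, hκ, hcyl⟩ := exists_mem_cyl_of_dE_lt hPi hF hSSC
  obtain ⟨C, hC, h⟩ := exists_fst_sub_mul_le_dE T
  refine ⟨κ / 2, by positivity, C * (κ / 2), by positivity, fun ii n => ?_⟩
  rw [map_fst_closedBall hPim, map_ballE hPim]
  refine le_trans ?_ (hQB.measure_inter (mem_strip_of_forall_cyl hPi _ _) ii n).2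
  refine ENNReal.toReal_mono (measure_ne_top _ _) (measure_mono ?_)
  intro jj hjj
  have hjj' : dE (Pi ii) (Pi jj) ≤ _ := hjj
  have hf := abs_pos.mpr (fxw_ne_zero T (word ii n) (coding_mem_sq hPi (shiftn ii n)))
  have hg := abs_pos.mpr (gyw_ne_zero T (word ii n) (coding_mem_sq hPi (shiftn ii n)))
  have h1 : jj ∈ cyl (word ii n) := hcyl ii jj n (hjj'.trans_lt (by
    have := mul_pos hκ hg
    linarith))
  refine ⟨h1, ?_⟩
  have h2 := h (word ii n) _ (coding_mem_sq hPi (shiftn ii n)) _ (coding_mem_sq hPi (shiftn jj n))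
  rw [← coding_eq_Sw hPi, ← word_eq_of_mem_cyl h1, ← coding_eq_Sw hPi, word_eq_of_mem_cyl h1] at h2
  change |(Pi (shiftn jj n)).1 - (Pi (shiftn ii n)).1| ≤ _
  rw [← mul_div_assoc, le_div_iff₀ hf, abs_sub_comm]
  refine h2.trans ?_
  rw [mul_assoc]
  gcongr

end Symbolic

end

section

/-! ### A maximal ergodic inequality and return times -/

section Maximal

variable {Ω : Type*} {τ : Ω → Ω}

/-- The maximum of the first `N + 1` Birkhoff sums of `u`. -/
def maxBirkhoff (τ : Ω → Ω) (u : Ω → ℝ) : ℕ → Ω → ℝ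
  | 0, _ => 0
  | N + 1, x => max 0 (u x + maxBirkhoff τ u N (τ x))

lemma maxBirkhoff_nonneg (u : Ω → ℝ) (N : ℕ) (x : Ω) : 0 ≤ maxBirkhoff τ u N x := by
  cases N with
  | zero => exact le_rfl
  | succ N => exact le_max_left _ _

lemma maxBirkhoff_le_succ (u : Ω → ℝ) (N : ℕ) (x : Ω) :
    maxBirkhoff τ u N x ≤ maxBirkhoff τ u (N + 1) x := by
  induction N generalizing x with
  | zero => exact maxBirkhoff_nonneg u 1 x
  | succ N ih => exact max_le_max le_rfl (add_le_add le_rfl (ih (τ x)))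

lemma birkhoffSum_le_maxBirkhoff (u : Ω → ℝ) (N : ℕ) (x : Ω) :
    birkhoffSum τ u N x ≤ maxBirkhoff τ u N x := by
  induction N generalizing x with
  | zero => simp [maxBirkhoff]
  | succ N ih =>
    rw [birkhoffSum_succ']
    exact (add_le_add le_rfl (ih (τ x))).trans (le_max_right _ _)

variable [MeasurableSpace Ω] {m : Measure Ω}

lemma integrable_maxBirkhoff (hτ : MeasurePreserving τ m m) {u : Ω → ℝ} (hu : Integrable u m)
    (N : ℕ) : Integrable (maxBirkhoff τ u N) m := by
  induction N with
  | zero => exact integrable_zero _ _ _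
  | succ N ih => exact (integrable_zero Ω ℝ m).sup (hu.add (hτ.integrable_comp_of_integrable ih))

lemma measurable_maxBirkhoff (hτ : Measurable τ) {u : Ω → ℝ} (hu : Measurable u) (N : ℕ) :
    Measurable (maxBirkhoff τ u N) := by
  induction N with
  | zero => exact measurable_const
  | succ N ih => exact measurable_const.max (hu.add (ih.comp hτ))

/-- The maximal ergodic theorem. -/
lemma setIntegral_maxBirkhoff_nonneg (hτ : MeasurePreserving τ m m) {u : Ω → ℝ}
    (hum : Measurable u) (hu : Integrable u m) (N : ℕ) :
    0 ≤ ∫ x in {x | 0 < maxBirkhoff τ u N x}, u x ∂m := by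
  have hE : MeasurableSet {x | 0 < maxBirkhoff τ u N x} :=
    measurableSet_lt measurable_const (measurable_maxBirkhoff hτ.measurable hum N)
  have hi := integrable_maxBirkhoff hτ hu N
  have hic : Integrable (fun x => maxBirkhoff τ u N (τ x)) m := hτ.integrable_comp_of_integrable hi
  have h0 : ∫ x, (maxBirkhoff τ u N x - maxBirkhoff τ u N (τ x)) ∂m = 0 := by
    rw [integral_sub hi hic]
    have h := integral_map (μ := m) (f := maxBirkhoff τ u N) hτ.measurable.aemeasurable
      (measurable_maxBirkhoff hτ.measurable hum N).aestronglyMeasurable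
    rw [hτ.map_eq] at h
    linarith
  rw [← integral_indicator hE]
  refine h0.symm.le.trans (integral_mono (hi.sub hic) (hu.indicator hE) fun x => ?_)
  by_cases hx : 0 < maxBirkhoff τ u N x
  · rw [indicator_of_mem (show x ∈ {x | 0 < maxBirkhoff τ u N x} from hx)]
    cases N with
    | zero => exact absurd hx (lt_irrefl _)
    | succ N =>
      have h1 : maxBirkhoff τ u (N + 1) x = u x + maxBirkhoff τ u N (τ x) := by
        have hx' : 0 < max 0 (u x + maxBirkhoff τ u N (τ x)) := hx
        have := (lt_max_iff.mp hx').resolve_left (lt_irrefl _)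
        exact max_eq_right this.le
      have h2 := maxBirkhoff_le_succ (τ := τ) u N (τ x)
      simp only
      linarith
  · rw [indicator_of_notMem (show x ∉ {x | 0 < maxBirkhoff τ u N x} from hx)]
    have h1 := maxBirkhoff_nonneg (τ := τ) u N (τ x)
    simp only
    linarith [not_lt.mp hx]

variable [IsProbabilityMeasure m]

lemma measure_exists_lt_birkhoffSum_le (hτ : MeasurePreserving τ m m) {A : Set Ω}
    (hA : MeasurableSet A) {c : ℝ} (hc : 0 < c) :
    m {x | ∃ n : ℕ, c * n < birkhoffSum τ (A.indicator 1) n x} ≤ ENNReal.ofReal (m.real A / c) := by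
  set u : Ω → ℝ := fun x => A.indicator 1 x - c with hu
  have hum : Measurable u := (measurable_one.indicator hA).sub measurable_const
  have hind : Integrable (A.indicator (1 : Ω → ℝ)) m := (integrable_const (1 : ℝ)).indicator hA
  have hui : Integrable u m := hind.sub (integrable_const c)
  set E : ℕ → Set Ω := fun N => {x | 0 < maxBirkhoff τ u N x} with hE
  have hEmono : Monotone E := monotone_nat_of_le_succ fun N x (hx : 0 < _) =>
    hx.trans_le (maxBirkhoff_le_succ u N x)
  have hbound : ∀ N, m (E N) ≤ ENNReal.ofReal (m.real A / c) := by
    intro N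
    have hEm : MeasurableSet (E N) :=
      measurableSet_lt measurable_const (measurable_maxBirkhoff hτ.measurable hum N)
    have h := setIntegral_maxBirkhoff_nonneg hτ hum hui N
    rw [integral_sub hind.integrableOn (integrable_const c).integrableOn,
      setIntegral_indicator hA, setIntegral_const] at h
    simp only [Pi.one_apply, setIntegral_const, smul_eq_mul, mul_one] at h
    have h2 : m.real (E N ∩ A) ≤ m.real A := measureReal_mono inter_subset_right
    have h3 : m.real (E N) ≤ m.real A / c := by
      rw [le_div_iff₀ hc]
      change 0 ≤ m.real (E N ∩ A) - m.real (E N) * c at h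
      linarith
    rw [← ofReal_measureReal (measure_ne_top m (E N))]
    exact ENNReal.ofReal_le_ofReal h3
  calc m {x | ∃ n : ℕ, c * n < birkhoffSum τ (A.indicator 1) n x} ≤ m (⋃ N, E N) := by
        refine measure_mono ?_
        rintro x ⟨n, hn⟩
        refine mem_iUnion.mpr ⟨n, lt_of_lt_of_le ?_ (birkhoffSum_le_maxBirkhoff u n x)⟩
        have : birkhoffSum τ u n x = birkhoffSum τ (A.indicator 1) n x - n * c := by
          simp [birkhoffSum, hu, Finset.sum_sub_distrib]
        rw [this]
        linarith
    _ = ⨆ N, m (E N) := hEmono.measure_iUnion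
    _ ≤ _ := iSup_le hbound

/-- Almost every orbit visits the complement of `A K`, for some `K`, with small gaps. -/
lemma ae_exists_return_times (hτ : MeasurePreserving τ m m) {A : ℕ → Set Ω}
    (hA : ∀ K, MeasurableSet (A K)) (hanti : Antitone A) (hnull : m (⋂ K, A K) = 0)
    {ε : ℝ} (hε : 0 < ε) :
    ∀ᵐ x ∂m, ∃ K, ∀ n : ℕ, 1 ≤ n → ∃ n' : ℕ, n ≤ n' ∧ (n' : ℝ) ≤ (1 + ε) * n ∧
      τ^[n'] x ∉ A K := by
  set c := ε / (2 + ε) with hc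
  have hc0 : 0 < c := by positivity
  have hae : ∀ᵐ x ∂m, ∃ K, ∀ n : ℕ, birkhoffSum τ ((A K).indicator 1) n x ≤ c * n := by
    rw [ae_iff]
    have hlim : Tendsto (fun K => ENNReal.ofReal (m.real (A K) / c)) atTop (nhds 0) := by
      have h1 : Tendsto (fun K => m.real (A K)) atTop (nhds (m.real (⋂ K, A K))) :=
        (ENNReal.tendsto_toReal (measure_ne_top _ _)).comp
          (tendsto_measure_iInter_atTop (fun k => (hA k).nullMeasurableSet) hanti
            ⟨0, measure_ne_top _ _⟩)
      rw [show m.real (⋂ K, A K) = 0 by simp [Measure.real, hnull]] at h1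
      have h2 := ENNReal.tendsto_ofReal (h1.div_const c)
      simpa using h2
    refine le_antisymm (ge_of_tendsto' hlim fun K => ?_) bot_le
    refine (measure_mono ?_).trans (measure_exists_lt_birkhoffSum_le hτ (hA K) hc0)
    intro x hx
    simp only [mem_ofPred_eq, not_exists, not_forall, not_le] at hx
    exact hx K
  filter_upwards [hae] with x hx
  obtain ⟨K, hK⟩ := hx
  refine ⟨K, fun n hn => ?_⟩
  by_contra hno
  push Not at hno
  set N := n + ⌊ε * n⌋₊ + 1 with hN
  have hn1 : (1 : ℝ) ≤ n := by exact_mod_cast hn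
  have hfl := Nat.floor_le (show 0 ≤ ε * n by positivity)
  have hfl' := Nat.lt_floor_add_one (ε * n)
  have hNr : (N : ℝ) = n + ⌊ε * n⌋₊ + 1 := by simp [hN]
  have hcount : ((⌊ε * n⌋₊ + 1 : ℕ) : ℝ) ≤ birkhoffSum τ ((A K).indicator 1) N x := by
    have hsub : Finset.Ico n N ⊆ Finset.range N := by
      intro k hk
      exact Finset.mem_range.mpr (Finset.mem_Ico.mp hk).2
    calc ((⌊ε * n⌋₊ + 1 : ℕ) : ℝ) = ∑ k ∈ Finset.Ico n N, (1 : ℝ) := by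
          simp [hN, add_assoc]
      _ = ∑ k ∈ Finset.Ico n N, (A K).indicator 1 (τ^[k] x) := by
          refine Finset.sum_congr rfl fun k hk => ?_
          obtain ⟨h1, h2⟩ := Finset.mem_Ico.mp hk
          have hk' : (k : ℝ) ≤ n + ⌊ε * n⌋₊ := by
            have : k ≤ n + ⌊ε * n⌋₊ := by omega
            exact_mod_cast this
          rw [indicator_of_mem (hno k h1 (by linarith)), Pi.one_apply]
      _ ≤ _ := Finset.sum_le_sum_of_subset_of_nonneg hsub fun k _ _ =>
          indicator_nonneg (fun _ _ => zero_le_one) _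
  have hK' := hK N
  rw [hNr] at hK'
  push_cast at hcount
  have h1 : c * ((2 + ε) * n) = ε * n := by rw [hc]; field_simp
  have h2 : c * (n + ⌊ε * n⌋₊ + 1) ≤ c * ((2 + ε) * n) := by
    gcongr
    linarith
  linarith

end Maximal

/-! ### Passing from a sparse sequence of scales to all scales -/

lemma eventually_le_of_sparse_scales {φ : ℝ → ℝ} (hφ : MonotoneOn φ (Ioi 0)) {r : ℕ → ℝ}
    (hr : ∀ n, 0 < r n) {χ D : ℝ} (hχ : χ < 0)
    (hlim : Tendsto (fun n : ℕ => Real.log (r n) / n) atTop (nhds χ))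
    (h : ∀ ε > 0, ∃ N : ℕ, ∀ n ≥ N, ∃ n' : ℕ, n ≤ n' ∧ (n' : ℝ) ≤ (1 + ε) * n ∧
      φ (r n') ≤ n' * (D + ε)) {ε : ℝ} (hε : 0 < ε) :
    ∀ᶠ x in nhdsWithin 0 (Ioi 0), φ x ≤ (D / χ + ε * (-1)) * Real.log x := by
  have hlimε : Tendsto (fun e : ℝ => |D| / (-χ) * (1 - (-χ) / ((-χ + e) * (1 + e))) + e / (-χ))
      (nhdsWithin 0 (Ioi 0)) (nhds 0) := by
    have hc : ContinuousAt (fun e : ℝ => |D| / (-χ) * (1 - (-χ) / ((-χ + e) * (1 + e))) + e / (-χ))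
        0 := by
      refine ContinuousAt.add (continuousAt_const.mul (continuousAt_const.sub
        (continuousAt_const.div (by fun_prop) ?_))) (by fun_prop)
      simp [hχ.ne]
    have h2 := hc.tendsto.mono_left (nhdsWithin_le_nhds (s := Ioi 0))
    simpa [hχ.ne] using h2
  obtain ⟨e, he, he0⟩ : ∃ e : ℝ,
      |D| / (-χ) * (1 - (-χ) / ((-χ + e) * (1 + e))) + e / (-χ) < ε / 2 ∧ 0 < e :=
    ((hlimε.eventually (gt_mem_nhds (half_pos hε))).and self_mem_nhdsWithin).exists
  obtain ⟨N, hN⟩ := h e he0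
  obtain ⟨N', hN'⟩ := eventually_atTop.mp (hlim.eventually (lt_mem_nhds (show χ - e < χ by linarith)))
  set X := -χ with hX
  have hX0 : 0 < X := by linarith
  set q := (X + e) * (1 + e) with hq
  have hq0 : 0 < q := by positivity
  have hb : Tendsto (fun x : ℝ => -Real.log x) (nhdsWithin 0 (Ioi 0)) atTop :=
    tendsto_neg_atBot_atTop.comp Real.tendsto_log_nhdsGT_zero
  filter_upwards [self_mem_nhdsWithin, hb.eventually_ge_atTop (q * (N + N' + 2)),
    hb.eventually_ge_atTop (2 * |D| / ε)] with x hx hx1 hx2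
  set b := -Real.log x with hbdef
  set n := ⌊b / q⌋₊ with hn
  have hb0 : 0 ≤ b := le_trans (by positivity) hx1
  have hnle : (n : ℝ) ≤ b / q := Nat.floor_le (by positivity)
  have hnge : b / q < n + 1 := Nat.lt_floor_add_one _
  have hbq : (N : ℝ) + N' + 2 ≤ b / q := by rw [le_div_iff₀ hq0]; linarith
  have hnN : N + N' + 1 ≤ n := by
    have : (N : ℝ) + N' + 1 < n + 0 := by linarith
    have h2 : ((N + N' + 1 : ℕ) : ℝ) < n := by push_cast; linarith
    exact_mod_cast h2.le
  obtain ⟨n', h1, h2, h3⟩ := hN n (by omega)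
  have hn'pos : (0 : ℝ) < n' := by
    have : 0 < n' := by omega
    exact_mod_cast this
  have hn1 : (n : ℝ) ≤ n' := by exact_mod_cast h1
  have hn'b : n' * (X + e) ≤ b := by
    have h4 : (n' : ℝ) ≤ (1 + e) * (b / q) := h2.trans (by gcongr)
    calc n' * (X + e) ≤ (1 + e) * (b / q) * (X + e) := by gcongr
      _ = b := by rw [hq]; field_simp
  have hlog : Real.log x ≤ Real.log (r n') := by
    have h5 := hN' n' (by omega)
    rw [lt_div_iff₀ hn'pos] at h5
    have : (χ - e) * n' = -(n' * (X + e)) := by rw [hX]; ring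
    linarith
  have hxr : x ≤ r n' := (Real.log_le_log_iff hx (hr n')).mp hlog
  refine (hφ hx (hr n') hxr).trans (h3.trans ?_)
  have hn'X : (n' : ℝ) ≤ b / X := by
    rw [le_div_iff₀ hX0]
    nlinarith
  have hDD : n' * D ≤ b / X * D + |D| * (b / X - n') := by
    have := neg_abs_le D
    nlinarith
  have hgap : |D| * (b / X - n') ≤ |D| * (b / X - b / q + 1) := by
    gcongr
    linarith
  have hDε : |D| ≤ ε / 2 * b := by
    rw [div_le_iff₀ hε] at hx2
    linarith
  have hmain : |D| * (b / X - b / q) + e * (b / X) ≤ ε / 2 * b := by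
    calc |D| * (b / X - b / q) + e * (b / X)
        = (|D| / X * (1 - X / q) + e / X) * b := by field_simp
      _ ≤ _ := by gcongr
  have hen : e * n' ≤ e * (b / X) := by gcongr
  have hfin : (D / χ + ε * (-1)) * Real.log x = b / X * D + ε * b := by
    rw [hbdef, hX]; field_simp
  rw [hfin]
  linarith

lemma eventually_ge_of_sparse_scales {φ : ℝ → ℝ} (hφ : MonotoneOn φ (Ioi 0)) {r : ℕ → ℝ}
    (hr : ∀ n, 0 < r n) {χ D : ℝ} (hχ : χ < 0)
    (hlim : Tendsto (fun n : ℕ => Real.log (r n) / n) atTop (nhds χ))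
    (h : ∀ ε > 0, ∃ N : ℕ, ∀ n ≥ N, ∃ n' : ℕ, n ≤ n' ∧ (n' : ℝ) ≤ (1 + ε) * n ∧
      n' * (D - ε) ≤ φ (r n')) {ε : ℝ} (hε : 0 < ε) :
    ∀ᶠ x in nhdsWithin 0 (Ioi 0), (D / χ + ε) * Real.log x ≤ φ x := by
  set X := -χ with hX
  have hX0 : 0 < X := by linarith
  have hlimε : Tendsto (fun e : ℝ => |D| * ((1 + e) / (X - e) - 1 / X) + e * ((1 + e) / (X - e)))
      (nhdsWithin 0 (Ioi 0)) (nhds 0) := by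
    have hdiv : ContinuousAt (fun e : ℝ => (1 + e) / (X - e)) 0 :=
      ContinuousAt.div (by fun_prop) (by fun_prop) (by simp [hX0.ne'])
    have hc : ContinuousAt
        (fun e : ℝ => |D| * ((1 + e) / (X - e) - 1 / X) + e * ((1 + e) / (X - e))) 0 :=
      (continuousAt_const.mul (hdiv.sub continuousAt_const)).add (continuousAt_id.mul hdiv)
    have h2 := hc.tendsto.mono_left (nhdsWithin_le_nhds (s := Ioi 0))
    simpa using h2
  obtain ⟨e, ⟨he, heX⟩, he0⟩ : ∃ e : ℝ,
      (|D| * ((1 + e) / (X - e) - 1 / X) + e * ((1 + e) / (X - e)) < ε / 2 ∧ e < X) ∧ 0 < e :=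
    (((hlimε.eventually (gt_mem_nhds (half_pos hε))).and
      ((gt_mem_nhds hX0).filter_mono nhdsWithin_le_nhds)).and self_mem_nhdsWithin).exists
  obtain ⟨N, hN⟩ := h e he0
  obtain ⟨N', hN'⟩ := eventually_atTop.mp (hlim.eventually (gt_mem_nhds (show χ < χ + e by linarith)))
  have hXe : 0 < X - e := by linarith
  have hb : Tendsto (fun x : ℝ => -Real.log x) (nhdsWithin 0 (Ioi 0)) atTop :=
    tendsto_neg_atBot_atTop.comp Real.tendsto_log_nhdsGT_zero
  filter_upwards [self_mem_nhdsWithin, hb.eventually_ge_atTop ((X - e) * (N + N' + 1)),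
    hb.eventually_ge_atTop (2 * ((|D| + e) * (1 + e)) / ε)] with x hx hx1 hx2
  set b := -Real.log x with hbdef
  set n := ⌈b / (X - e)⌉₊ with hn
  have hb0 : 0 ≤ b := le_trans (by positivity) hx1
  have hnge : b / (X - e) ≤ n := Nat.le_ceil _
  have hnle : (n : ℝ) < b / (X - e) + 1 := Nat.ceil_lt_add_one (by positivity)
  have hnN : N + N' + 1 ≤ n := by
    have h2 : ((N + N' + 1 : ℕ) : ℝ) ≤ n := by
      push_cast
      refine le_trans ?_ hnge
      rw [le_div_iff₀ hXe]
      linarith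
    exact_mod_cast h2
  obtain ⟨n', h1, h2, h3⟩ := hN n (by omega)
  have hn'pos : (0 : ℝ) < n' := by
    have : 0 < n' := by omega
    exact_mod_cast this
  have hn1 : (n : ℝ) ≤ n' := by exact_mod_cast h1
  have hn'b : b ≤ n' * (X - e) := by
    rw [← div_le_iff₀ hXe]
    linarith
  have hlog : Real.log (r n') ≤ Real.log x := by
    have h5 := hN' n' (by omega)
    rw [div_lt_iff₀ hn'pos] at h5
    have : (χ + e) * n' = -(n' * (X - e)) := by rw [hX]; ring
    linarith
  have hxr : r n' ≤ x := (Real.log_le_log_iff (hr n') hx).mp hlog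
  refine le_trans ?_ (h3.trans (hφ (hr n') hx hxr))
  have hn'X : b / X ≤ (n' : ℝ) := by
    rw [div_le_iff₀ hX0]
    nlinarith
  have hn'up : (n' : ℝ) ≤ (1 + e) / (X - e) * b + (1 + e) := by
    calc (n' : ℝ) ≤ (1 + e) * n := h2
      _ ≤ (1 + e) * (b / (X - e) + 1) := by gcongr
      _ = _ := by ring
  have hDD : b / X * D - |D| * (n' - b / X) ≤ n' * D := by
    have := neg_abs_le D
    nlinarith
  have hgap : |D| * (n' - b / X) ≤ |D| * ((1 + e) / (X - e) * b + (1 + e) - b / X) := by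
    gcongr
  have hen : e * n' ≤ e * ((1 + e) / (X - e) * b + (1 + e)) := by gcongr
  have hDε : (|D| + e) * (1 + e) ≤ ε / 2 * b := by
    rw [div_le_iff₀ hε] at hx2
    linarith
  have hmain : (|D| * ((1 + e) / (X - e) - 1 / X) + e * ((1 + e) / (X - e))) * b ≤ ε / 2 * b := by
    gcongr
  have hfin : (D / χ + ε) * Real.log x = b / X * D - ε * b := by
    rw [hbdef, hX]; field_simp; ring
  rw [hfin]
  have hexp : |D| * ((1 + e) / (X - e) * b + (1 + e) - b / X) +
      e * ((1 + e) / (X - e) * b + (1 + e)) =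
      (|D| * ((1 + e) / (X - e) - 1 / X) + e * ((1 + e) / (X - e))) * b +
        (|D| + e) * (1 + e) := by ring
  linarith

end

section

section Scales

variable {M : ℝ → ℝ} {G R u : ℕ → ℝ} {v : ℕ → ℝ → ℝ} {L h χ Δ t : ℝ}

/-- Two-sided control of `M` along the scales `G n` at return times determines the limit of
`log M / log`. -/
lemma tendsto_log_div_log_of_return_times (hMpos : ∀ r > 0, 0 < M r) (hMmono : Monotone M)
    (hL : 0 < L) (hG : ∀ n, 0 < G n) (hR : ∀ n, 0 < R n) (hu : ∀ n, 0 < u n)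
    {C κ C' : ℝ} (hC : 0 < C) (hκ : 0 < κ) (hC' : 0 < C')
    (hlow : ∀ n, L⁻¹ * u n * v n (R n) ≤ M (C * G n))
    (hupp : ∀ n, M (κ * G n) ≤ L * u n * v n (C' * R n)) (hχ : χ < 0)
    (hul : Tendsto (fun n : ℕ => Real.log (u n) / n) atTop (nhds h))
    (hGl : Tendsto (fun n : ℕ => Real.log (G n) / n) atTop (nhds χ))
    (hRl : Tendsto (fun n : ℕ => Real.log (R n) / n) atTop (nhds Δ))
    (hR0 : Tendsto R atTop (nhds 0))
    (hret : ∀ ε > 0, ∃ ρ₀ > 0, ∀ n : ℕ, 1 ≤ n → ∃ n' : ℕ, n ≤ n' ∧ (n' : ℝ) ≤ (1 + ε) * n ∧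
      ∀ ρ, 0 < ρ → ρ < ρ₀ → 0 < v n' ρ ∧ (t + ε) * Real.log ρ ≤ Real.log (v n' ρ) ∧
        Real.log (v n' ρ) ≤ (t - ε) * Real.log ρ) :
    Tendsto (fun r => Real.log (M r) / Real.log r) (nhdsWithin 0 (Ioi 0))
      (nhds ((h + Δ * t) / χ)) := by
  have hφ : MonotoneOn (fun r => Real.log (M r)) (Ioi 0) := fun x hx y _ hxy =>
    Real.log_le_log (hMpos x hx) (hMmono hxy)
  have hscale : ∀ c : ℝ, 0 < c →
      Tendsto (fun n : ℕ => Real.log (c * G n) / n) atTop (nhds χ) := by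
    intro c hc
    have h1 := (tendsto_const_div_atTop_nhds_zero_nat (Real.log c)).add hGl
    rw [zero_add] at h1
    refine h1.congr fun n => ?_
    rw [Real.log_mul hc.ne' (hG n).ne', add_div]
  have hcomb : ∀ a b s : ℝ, Tendsto (fun n : ℕ =>
      (a + Real.log (u n) + s * (b + Real.log (R n))) / n) atTop (nhds (h + s * Δ)) := by
    intro a b s
    have h1 := ((tendsto_const_div_atTop_nhds_zero_nat (a + s * b)).add hul).add (hRl.const_mul s)
    rw [zero_add] at h1
    refine h1.congr fun n => ?_
    ring
  have hsmall : ∀ ε : ℝ, 0 < ε → ∃ e > 0, e ≤ ε ∧ e * |Δ| < ε := by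
    intro ε hε
    refine ⟨ε / (1 + |Δ|), by positivity, div_le_self hε.le (by linarith [abs_nonneg Δ]), ?_⟩
    rw [div_mul_eq_mul_div, div_lt_iff₀ (by positivity)]
    linarith
  have hle := fun ε hε => eventually_le_of_sparse_scales (D := h + Δ * t) hφ
    (r := fun n => κ * G n) (fun n => mul_pos hκ (hG n)) hχ (hscale κ hκ) (by
      intro ε hε
      obtain ⟨e, he0, heε, heΔ⟩ := hsmall ε hε
      obtain ⟨ρ₀, hρ₀, hret'⟩ := hret e he0
      have hlim := hcomb (Real.log L) (Real.log C') (t - e)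
      have hlt : h + (t - e) * Δ < h + Δ * t + ε := by
        have := neg_abs_le Δ
        nlinarith
      have hC'R : ∀ᶠ n in atTop, C' * R n < ρ₀ := by
        have := hR0.const_mul C'
        rw [mul_zero] at this
        exact this.eventually (gt_mem_nhds hρ₀)
      obtain ⟨N, hN⟩ := eventually_atTop.mp ((hlim.eventually (gt_mem_nhds hlt)).and hC'R)
      refine ⟨N + 1, fun n hn => ?_⟩
      obtain ⟨n', h1, h2, h3⟩ := hret' n (by omega)
      refine ⟨n', h1, h2.trans (by gcongr), ?_⟩
      obtain ⟨h4, h5⟩ := hN n' (by omega)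
      have hn' : (0 : ℝ) < n' := by exact_mod_cast (show 0 < n' by omega)
      obtain ⟨h6, -, h8⟩ := h3 (C' * R n') (mul_pos hC' (hR n')) h5
      have h9 := Real.log_le_log (hMpos _ (mul_pos hκ (hG n'))) (hupp n')
      rw [Real.log_mul (mul_pos hL (hu n')).ne' h6.ne', Real.log_mul hL.ne' (hu n').ne'] at h9
      rw [Real.log_mul hC'.ne' (hR n').ne'] at h8
      rw [div_lt_iff₀ hn'] at h4
      change Real.log (M (κ * G n')) ≤ _
      linarith) (ε := ε) hε
  have hge := fun ε hε => eventually_ge_of_sparse_scales (D := h + Δ * t) hφ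
    (r := fun n => C * G n) (fun n => mul_pos hC (hG n)) hχ (hscale C hC) (by
      intro ε hε
      obtain ⟨e, he0, heε, heΔ⟩ := hsmall ε hε
      obtain ⟨ρ₀, hρ₀, hret'⟩ := hret e he0
      have hlim := hcomb (Real.log L⁻¹) 0 (t + e)
      have hlt : h + Δ * t - ε < h + (t + e) * Δ := by
        have := neg_abs_le Δ
        nlinarith
      obtain ⟨N, hN⟩ := eventually_atTop.mp ((hlim.eventually (lt_mem_nhds hlt)).and
        (hR0.eventually (gt_mem_nhds hρ₀)))
      refine ⟨N + 1, fun n hn => ?_⟩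
      obtain ⟨n', h1, h2, h3⟩ := hret' n (by omega)
      refine ⟨n', h1, h2.trans (by gcongr), ?_⟩
      obtain ⟨h4, h5⟩ := hN n' (by omega)
      have hn' : (0 : ℝ) < n' := by exact_mod_cast (show 0 < n' by omega)
      obtain ⟨h6, h7, -⟩ := h3 (R n') (hR n') h5
      have hL' := inv_pos.mpr hL
      have h9 := Real.log_le_log (mul_pos (mul_pos hL' (hu n')) h6) (hlow n')
      rw [Real.log_mul (mul_pos hL' (hu n')).ne' h6.ne', Real.log_mul hL'.ne' (hu n').ne'] at h9
      rw [lt_div_iff₀ hn', zero_add] at h4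
      change _ ≤ Real.log (M (C * G n'))
      linarith) (ε := ε) hε
  rw [Metric.tendsto_nhds]
  intro ε hε
  have hlt1 : ∀ᶠ x : ℝ in nhdsWithin 0 (Ioi 0), x < 1 :=
    (gt_mem_nhds one_pos).filter_mono nhdsWithin_le_nhds
  filter_upwards [hle (ε / 2) (half_pos hε), hge (ε / 2) (half_pos hε), hlt1, self_mem_nhdsWithin]
    with x h1 h2 h3 h4
  have hlog : Real.log x < 0 := Real.log_neg h4 h3
  have h5 : (h + Δ * t) / χ - ε / 2 ≤ Real.log (M x) / Real.log x := by
    rw [le_div_iff_of_neg hlog]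
    linarith
  have h6 : Real.log (M x) / Real.log x ≤ (h + Δ * t) / χ + ε / 2 := by
    rw [div_le_iff_of_neg hlog]
    linarith
  rw [Real.dist_eq, abs_lt]
  constructor <;> linarith

end Scales

/-! ### Uniformity of the local dimension of the projected measure -/

lemma measurable_measure_closedBall (ν : Measure ℝ) [IsFiniteMeasure ν] (r : ℝ) :
    Measurable fun x => ν (Metric.closedBall x r) := by
  have h : MeasurableSet {p : ℝ × ℝ | dist p.2 p.1 ≤ r} :=
    (isClosed_le (by fun_prop) continuous_const).measurableSet
  exact measurable_measure_prodMk_left h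

lemma exists_antitone_uniform_dimension {Ω : Type*} [MeasurableSpace Ω] {m : Measure Ω}
    {ν : Measure ℝ} [IsFiniteMeasure ν] {X : Ω → ℝ} (hX : Measurable X) {t : ℝ}
    (hpos : ∀ᵐ ω ∂m, ∀ r > 0, 0 < (ν (Metric.closedBall (X ω) r)).toReal)
    (hdim : ∀ᵐ ω ∂m, Tendsto
      (fun r => Real.log (ν (Metric.closedBall (X ω) r)).toReal / Real.log r)
      (nhdsWithin 0 (Ioi 0)) (nhds t)) {ε : ℝ} (hε : 0 < ε) :
    ∃ A : ℕ → Set Ω, (∀ K, MeasurableSet (A K)) ∧ Antitone A ∧ m (⋂ K, A K) = 0 ∧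
      ∀ K, ∃ ρ₀ > 0, ∀ ω, ω ∉ A K → ∀ ρ, 0 < ρ → ρ < ρ₀ →
        0 < (ν (Metric.closedBall (X ω) ρ)).toReal ∧
        (t + ε) * Real.log ρ ≤ Real.log (ν (Metric.closedBall (X ω) ρ)).toReal ∧
        Real.log (ν (Metric.closedBall (X ω) ρ)).toReal ≤ (t - ε) * Real.log ρ := by
  set l := Real.log 2 with hl
  have hl0 : 0 < l := Real.log_pos one_lt_two
  set v : Ω → ℝ → ℝ := fun ω r => (ν (Metric.closedBall (X ω) r)).toReal with hv
  have hvm : ∀ r, Measurable fun ω => v ω r := fun r =>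
    ((measurable_measure_closedBall ν r).comp hX).ennreal_toReal
  have hvmono : ∀ ω, Monotone (v ω) := fun ω a b hab =>
    ENNReal.toReal_mono (measure_ne_top _ _) (measure_mono (Metric.closedBall_subset_closedBall hab))
  have hlogpow : ∀ k : ℕ, Real.log ((1 / 2 : ℝ) ^ k) = -(k * l) := by
    intro k
    rw [Real.log_pow, one_div, Real.log_inv]
    ring
  set B : ℕ → Set Ω := fun k => {ω | 0 < v ω ((1 / 2) ^ k) ∧
    |Real.log (v ω ((1 / 2) ^ k)) + k * l * t| ≤ ε / 2 * (k * l)} with hB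
  have hBm : ∀ k, MeasurableSet (B k) := fun k =>
    (measurableSet_lt measurable_const (hvm _)).inter
      (measurableSet_le (continuous_abs.measurable.comp ((Real.measurable_log.comp (hvm _)).add_const _))
        measurable_const)
  refine ⟨fun K => ⋃ k, ⋃ (_ : K ≤ k), (B k)ᶜ, fun K => ?_, ?_, ?_, ?_⟩
  · exact MeasurableSet.iUnion fun k => MeasurableSet.iUnion fun _ => (hBm k).compl
  · intro K K' hK ω hω
    simp only [mem_iUnion] at hω ⊢
    obtain ⟨k, h1, h2⟩ := hω
    exact ⟨k, hK.trans h1, h2⟩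
  · refine measure_mono_null (t := {ω | ¬ ∃ K, ∀ k, K ≤ k → ω ∈ B k}) ?_ (ae_iff.mp ?_)
    · rintro ω hω ⟨K, hK⟩
      obtain ⟨k, h1, h2⟩ := by simpa only [mem_iUnion, exists_prop] using mem_iInter.mp hω K
      exact h2 (hK k h1)
    · filter_upwards [hpos, hdim] with ω h1 h2
      have hseq : Tendsto (fun k : ℕ => (1 / 2 : ℝ) ^ k) atTop (nhdsWithin 0 (Ioi 0)) :=
        tendsto_nhdsWithin_iff.mpr ⟨tendsto_pow_atTop_nhds_zero_of_lt_one (by norm_num) (by norm_num),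
          Eventually.of_forall fun k => by simp⟩
      have h3 := (h2.comp hseq).eventually (Metric.closedBall_mem_nhds t (half_pos hε))
      obtain ⟨K, hK⟩ := eventually_atTop.mp h3
      refine ⟨K + 1, fun k hk => ⟨h1 _ (by positivity), ?_⟩⟩
      have h4 := hK k (by omega)
      have hkl : 0 < k * l := mul_pos (by exact_mod_cast (show 0 < k by omega)) hl0
      simp only [Function.comp_apply, hlogpow, Real.dist_eq] at h4
      have h5 : Real.log (v ω ((1 / 2) ^ k)) + k * l * t =
          -((Real.log (v ω ((1 / 2) ^ k)) / -(k * l) - t) * (k * l)) := by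
        rw [sub_mul, div_neg, neg_mul, div_mul_cancel₀ _ hkl.ne']
        ring
      rw [h5, abs_neg, abs_mul, abs_of_pos hkl]
      exact mul_le_mul_of_nonneg_right h4 hkl.le
  · intro K
    set Q := (|t| + ε / 2) * l * (2 / ε) + K * l with hQ
    have hQ0 : 0 ≤ Q := by positivity
    refine ⟨Real.exp (-Q), Real.exp_pos _, fun ω hω ρ hρ hρ' => ?_⟩
    have hgood : ∀ k, K ≤ k → ω ∈ B k := by
      intro k hk
      by_contra hno
      exact hω (mem_iUnion₂.mpr ⟨k, hk, hno⟩)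
    have hρ1 : ρ ≤ 1 := hρ'.le.trans (Real.exp_le_one_iff.mpr (by linarith))
    obtain ⟨n, hn1, hn2⟩ := exists_nat_pow_near_of_lt_one hρ hρ1 (show (0 : ℝ) < 1 / 2 by norm_num)
      (by norm_num)
    have hlogρ : Real.log ρ < -Q := (Real.log_lt_iff_lt_exp hρ).mpr hρ'
    have hb1 := Real.log_lt_log (by positivity) hn1
    have hb2 := Real.log_le_log hρ hn2
    rw [hlogpow] at hb1 hb2
    push_cast at hb1
    set b := -Real.log ρ with hb
    have hlb : Real.log ρ = -b := by rw [hb, neg_neg]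
    rw [hlb] at hb1 hb2 hlogρ
    have hterm : 0 ≤ (|t| + ε / 2) * l * (2 / ε) := by positivity
    have hKn : K ≤ n := by
      have h1 : (K : ℝ) * l < (n + 1) * l := by linarith
      have h2 := lt_of_mul_lt_mul_right h1 hl0.le
      have h3 : K < n + 1 := by exact_mod_cast h2
      omega
    have hbig : (|t| + ε / 2) * l ≤ ε / 2 * b := by
      have hKl : 0 ≤ (K : ℝ) * l := by positivity
      calc (|t| + ε / 2) * l = ε / 2 * ((|t| + ε / 2) * l * (2 / ε)) := by field_simp
        _ ≤ ε / 2 * b := by gcongr; linarith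
    obtain ⟨g1, g2⟩ := hgood n hKn
    obtain ⟨g3, g4⟩ := hgood (n + 1) (by omega)
    rw [abs_le] at g2 g4
    push_cast at g4
    have hvpos : 0 < v ω ρ := g3.trans_le (hvmono ω hn1.le)
    have hlow := Real.log_le_log g3 (hvmono ω hn1.le)
    have hupp := Real.log_le_log hvpos (hvmono ω hn2)
    have ht1 : t * (b - n * l) ≤ |t| * l := by
      calc t * (b - n * l) ≤ |t| * (b - n * l) :=
            mul_le_mul_of_nonneg_right (le_abs_self t) (by linarith)
        _ ≤ |t| * l := by gcongr; linarith
    have ht2 : t * ((n + 1) * l - b) ≤ |t| * l := by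
      calc t * ((n + 1) * l - b) ≤ |t| * ((n + 1) * l - b) :=
            mul_le_mul_of_nonneg_right (le_abs_self t) (by linarith)
        _ ≤ |t| * l := by gcongr; linarith
    have he1 : ε / 2 * (n * l) ≤ ε / 2 * b := by gcongr; linarith
    have he2 : ε / 2 * ((n + 1) * l) ≤ ε / 2 * (b + l) := by gcongr; linarith
    have hεl : 0 ≤ ε / 2 * l := by positivity
    refine ⟨hvpos, ?_, ?_⟩
    · rw [hlb]
      change _ ≤ Real.log (v ω ρ)
      linarith [g4.1]
    · rw [hlb]
      change Real.log (v ω ρ) ≤ _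
      linarith [g2.2]

end

section

lemma tendsto_div_of_abs_sub_le {a b : ℕ → ℝ} {K l : ℝ} (hab : ∀ n, |a n - b n| ≤ K)
    (ha : Tendsto (fun n : ℕ => a n / n) atTop (nhds l)) :
    Tendsto (fun n : ℕ => b n / n) atTop (nhds l) := by
  have h : Tendsto (fun n : ℕ => (a n - b n) / n) atTop (nhds 0) := by
    refine squeeze_zero_norm (fun n => ?_) (tendsto_const_div_atTop_nhds_zero_nat K)
    rw [Real.norm_eq_abs, abs_div, Nat.abs_cast]
    exact div_le_div_of_nonneg_right (hab n) n.cast_nonneg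
  have h2 := ha.sub h
  rw [sub_zero] at h2
  exact h2.congr fun n => by ring

lemma iterate_shift {I : Type} (n : ℕ) (ii : ℕ → I) : shift^[n] ii = shiftn ii n := by
  induction n generalizing ii with
  | zero => rfl
  | succ n ih =>
    rw [Function.iterate_succ_apply, ih]
    funext k
    simp only [shift, shiftn]
    congr 1

section Positivity

variable {I : Type} [Fintype I] [MeasurableSpace I] {T : System I} {Pi : (ℕ → I) → ℝ × ℝ}
  {m : Measure (ℕ → I)}

lemma ae_measure_cyl_pos : ∀ᵐ ii ∂m, ∀ n, 0 < m (cyl (word ii n)) := by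
  rw [ae_all_iff]
  intro n
  rw [ae_iff]
  refine measure_mono_null (t := ⋃ w : {w : List I // m (cyl w) = 0}, cyl w.1) ?_
    (measure_iUnion_null fun w => w.2)
  intro ii hii
  exact mem_iUnion.mpr ⟨⟨word ii n, by simpa using hii⟩, mem_cyl_word.mpr fun _ _ => rfl⟩

lemma measure_ball_pos [IsProbabilityMeasure m] (hPi : IsCoding T Pi) (hPim : Measurable Pi) {ii : ℕ → I}
    (hii : ∀ n, 0 < m (cyl (word ii n))) {r : ℝ} (hr : 0 < r) :
    0 < ((m.map Pi) (ballE (Pi ii) r)).toReal ∧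
      0 < (((m.map Pi).map Prod.fst) (Metric.closedBall (Pi ii).1 r)).toReal := by
  obtain ⟨c, h0, h1, hc⟩ := dE_coding_le hPi
  obtain ⟨n, hn⟩ := ((tendsto_two_mul_pow h0 h1).eventually (gt_mem_nhds hr)).exists
  rw [map_ballE hPim, map_fst_closedBall hPim]
  constructor <;>
  refine ENNReal.toReal_pos ((hii n).trans_le (measure_mono fun jj hjj => ?_)).ne'
    (measure_ne_top _ _)
  · exact (hc ii n jj hjj).trans hn.le
  · change |(Pi jj).1 - (Pi ii).1| ≤ r
    rw [abs_sub_comm]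
    exact (abs_fst_sub_le_dE _ _).trans ((hc ii n jj hjj).trans hn.le)

end Positivity

section Main

variable {I : Type} [Fintype I] [MeasurableSpace I] {T : System I} {F : Set (ℝ × ℝ)}
  {Pi : (ℕ → I) → ℝ × ℝ} {m : Measure (ℕ → I)} [IsProbabilityMeasure m]

/-- Almost every symbolic orbit returns, with small gaps, to points at which the local dimension
of the projected measure is uniformly close to `t`. -/
lemma ae_return_to_uniform_dimension (hPi : IsCoding T Pi) (hPim : Measurable Pi)
    (hshift : MeasurePreserving (shift : (ℕ → I) → ℕ → I) m m) {t : ℝ}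
    (hproj : ExactDim1 ((m.map Pi).map Prod.fst) t) :
    ∀ᵐ ii ∂m, ∀ ε > 0, ∃ ρ₀ > 0, ∀ n : ℕ, 1 ≤ n → ∃ n' : ℕ, n ≤ n' ∧ (n' : ℝ) ≤ (1 + ε) * n ∧
      ∀ ρ, 0 < ρ → ρ < ρ₀ →
        0 < (((m.map Pi).map Prod.fst) (Metric.closedBall (Pi (shiftn ii n')).1 ρ)).toReal ∧
        (t + ε) * Real.log ρ ≤ Real.log
          (((m.map Pi).map Prod.fst) (Metric.closedBall (Pi (shiftn ii n')).1 ρ)).toReal ∧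
        Real.log (((m.map Pi).map Prod.fst)
          (Metric.closedBall (Pi (shiftn ii n')).1 ρ)).toReal ≤ (t - ε) * Real.log ρ := by
  set ν := (m.map Pi).map Prod.fst with hν
  have hX : Measurable fun ii => (Pi ii).1 := measurable_fst.comp hPim
  have hpos : ∀ᵐ ii ∂m, ∀ r > 0, 0 < (ν (Metric.closedBall (Pi ii).1 r)).toReal := by
    filter_upwards [ae_measure_cyl_pos (m := m)] with ii hii r hr
    exact (measure_ball_pos hPi hPim hii hr).2
  have hdim := ae_of_ae_map hPim.aemeasurable (ae_of_ae_map measurable_fst.aemeasurable hproj)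
  have key : ∀ q : ℕ, ∀ᵐ ii ∂m, ∃ ρ₀ > 0, ∀ n : ℕ, 1 ≤ n → ∃ n' : ℕ, n ≤ n' ∧
      (n' : ℝ) ≤ (1 + 1 / ((q : ℝ) + 1)) * n ∧ ∀ ρ, 0 < ρ → ρ < ρ₀ →
        0 < (ν (Metric.closedBall (Pi (shiftn ii n')).1 ρ)).toReal ∧
        (t + 1 / ((q : ℝ) + 1)) * Real.log ρ ≤
          Real.log (ν (Metric.closedBall (Pi (shiftn ii n')).1 ρ)).toReal ∧
        Real.log (ν (Metric.closedBall (Pi (shiftn ii n')).1 ρ)).toReal ≤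
          (t - 1 / ((q : ℝ) + 1)) * Real.log ρ := by
    intro q
    have hq : 0 < 1 / ((q : ℝ) + 1) := by positivity
    obtain ⟨A, hAm, hAa, hA0, hA⟩ := exists_antitone_uniform_dimension hX hpos hdim hq
    filter_upwards [ae_exists_return_times hshift hAm hAa hA0 hq] with ii hii
    obtain ⟨K, hK⟩ := hii
    obtain ⟨ρ₀, hρ₀, hAK⟩ := hA K
    refine ⟨ρ₀, hρ₀, fun n hn => ?_⟩
    obtain ⟨n', h1, h2, h3⟩ := hK n hn
    rw [iterate_shift] at h3
    exact ⟨n', h1, h2, fun ρ h4 h5 => hAK _ h3 ρ h4 h5⟩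
  filter_upwards [ae_all_iff.mpr key] with ii hii ε hε
  obtain ⟨q, hq⟩ := exists_nat_one_div_lt hε
  obtain ⟨ρ₀, hρ₀, h⟩ := hii q
  refine ⟨min ρ₀ 1, lt_min hρ₀ one_pos, fun n hn => ?_⟩
  obtain ⟨n', h1, h2, h3⟩ := h n hn
  refine ⟨n', h1, h2.trans (by gcongr), fun ρ h4 h5 => ?_⟩
  obtain ⟨h6, h7, h8⟩ := h3 ρ h4 (h5.trans_le (min_le_left _ _))
  have hlog : Real.log ρ ≤ 0 := Real.log_nonpos h4.le (h5.le.trans (min_le_right _ _))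
  exact ⟨h6, (mul_le_mul_of_nonpos_right (by linarith) hlog).trans h7,
    h8.trans (mul_le_mul_of_nonpos_right (by linarith) hlog)⟩

lemma tendsto_local_dimension (hPi : IsCoding T Pi) (hF : IsAttractor T F) (hSSC : SSC T F)
    (hPim : Measurable Pi) {L : ℝ} (hQB : QuasiBernoulli m L) {h χ₁ χ₂ t : ℝ} (hχ2 : χ₂ < 0)
    {ii : ℕ → I} (hii : ∀ n, 0 < m (cyl (word ii n)))
    (hent : Tendsto (fun n : ℕ => Real.log (m (cyl (word ii n))).toReal / n) atTop (nhds h))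
    (hly1 : Tendsto
      (fun n : ℕ => Real.log (alpha1 T (word ii n) (Pi (shiftn ii n))) / n) atTop (nhds χ₁))
    (hly2 : Tendsto
      (fun n : ℕ => Real.log (alpha2 T (word ii n) (Pi (shiftn ii n))) / n) atTop (nhds χ₂))
    (hret : ∀ ε > 0, ∃ ρ₀ > 0, ∀ n : ℕ, 1 ≤ n → ∃ n' : ℕ, n ≤ n' ∧ (n' : ℝ) ≤ (1 + ε) * n ∧
      ∀ ρ, 0 < ρ → ρ < ρ₀ →
        0 < (((m.map Pi).map Prod.fst) (Metric.closedBall (Pi (shiftn ii n')).1 ρ)).toReal ∧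
        (t + ε) * Real.log ρ ≤ Real.log
          (((m.map Pi).map Prod.fst) (Metric.closedBall (Pi (shiftn ii n')).1 ρ)).toReal ∧
        Real.log (((m.map Pi).map Prod.fst)
          (Metric.closedBall (Pi (shiftn ii n')).1 ρ)).toReal ≤ (t - ε) * Real.log ρ) :
    Tendsto (fun r => Real.log ((m.map Pi) (ballE (Pi ii) r)).toReal / Real.log r)
      (nhdsWithin 0 (Ioi 0)) (nhds ((h + (χ₂ - χ₁) * t) / χ₂)) := by
  have := measurableSingletonClass_of_coding hPi hF hSSC hPim
  have := Measure.isProbabilityMeasure_map (μ := m) hPim.aemeasurable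
  obtain ⟨C, hC, hlow⟩ := exists_le_measure_ballE hPi hPim hQB
  obtain ⟨κ, hκ, C', hC', hupp⟩ := exists_measure_ballE_le hPi hF hSSC hPim hQB
  obtain ⟨K, hK⟩ := exists_abs_log_alpha_sub_le T
  obtain ⟨η, hη0, hη1, hη⟩ := exists_abs_gyw_le T
  have hsq : ∀ n, Pi (shiftn ii n) ∈ sq := fun n => coding_mem_sq hPi _
  have hG : ∀ n, 0 < |gyw T (word ii n) (Pi (shiftn ii n))| := fun n =>
    abs_pos.mpr (gyw_ne_zero T _ (hsq n))
  have hFx : ∀ n, 0 < |fxw T (word ii n) (Pi (shiftn ii n))| := fun n =>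
    abs_pos.mpr (fxw_ne_zero T _ (hsq n))
  have hGl := tendsto_div_of_abs_sub_le (fun n => (hK (word ii n) _ (hsq n)).2) hly2
  have hFl := tendsto_div_of_abs_sub_le (fun n => (hK (word ii n) _ (hsq n)).1) hly1
  refine tendsto_log_div_log_of_return_times
    (M := fun r => ((m.map Pi) (ballE (Pi ii) r)).toReal)
    (G := fun n => |gyw T (word ii n) (Pi (shiftn ii n))|)
    (R := fun n => |gyw T (word ii n) (Pi (shiftn ii n))| / |fxw T (word ii n) (Pi (shiftn ii n))|)
    (u := fun n => (m (cyl (word ii n))).toReal)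
    (v := fun n ρ => (((m.map Pi).map Prod.fst) (Metric.closedBall (Pi (shiftn ii n)).1 ρ)).toReal)
    (fun r hr => (measure_ball_pos hPi hPim hii hr).1)
    (fun a b hab => ENNReal.toReal_mono (measure_ne_top _ _)
      (measure_mono fun y (hy : dE _ _ ≤ a) => le_trans hy hab))
    hQB.1 hG (fun n => div_pos (hG n) (hFx n))
    (fun n => ENNReal.toReal_pos (hii n).ne' (measure_ne_top _ _)) hC hκ hC'
    (hlow ii) (hupp ii) hχ2 hent hGl ?_ ?_ hret
  · refine (hGl.sub hFl).congr fun n => ?_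
    rw [Real.log_div (hG n).ne' (hFx n).ne', sub_div]
  · refine squeeze_zero (fun n => (div_pos (hG n) (hFx n)).le) (fun n => ?_)
      (tendsto_pow_atTop_nhds_zero_of_lt_one hη0.le hη1)
    rw [div_le_iff₀ (hFx n)]
    simpa only [word_length] using hη (word ii n) _ (hsq n)

end Main

end

end FFL

/-- the Ledrappier–Young formula for pushforward quasi-Bernoulli measures
on the attractors of Falconer–Fraser–Lee systems. -/
theorem stmt0 {I : Type} [Fintype I] [MeasurableSpace I] (T : System I)
    (F : Set (ℝ × ℝ)) (hF : IsAttractor T F) (hSSC : SSC T F)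
    (Pi : (ℕ → I) → ℝ × ℝ) (hPi : IsCoding T Pi) (hPim : Measurable Pi)
    (m : Measure (ℕ → I)) [IsProbabilityMeasure m]
    (hshift : MeasurePreserving (shift : (ℕ → I) → ℕ → I) m m)
    (L : ℝ) (hQB : QuasiBernoulli m L)
    (h χ₁ χ₂ t : ℝ) (hh : h ≤ 0) (hχ21 : χ₂ ≤ χ₁) (hχ1 : χ₁ < 0)
    (hent : ∀ᵐ ii ∂m, Tendsto
      (fun n : ℕ => Real.log (m (cyl (word ii n))).toReal / n) atTop (nhds h))
    (hly1 : ∀ᵐ ii ∂m, Tendsto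
      (fun n : ℕ => Real.log (alpha1 T (word ii n) (Pi (shiftn ii n))) / n) atTop (nhds χ₁))
    (hly2 : ∀ᵐ ii ∂m, Tendsto
      (fun n : ℕ => Real.log (alpha2 T (word ii n) (Pi (shiftn ii n))) / n) atTop (nhds χ₂))
    (hproj : ExactDim1 ((m.map Pi).map Prod.fst) t) :
    ExactDim2 (m.map Pi) (h / χ₂ + (χ₂ - χ₁) / χ₂ * t) := by
  have := measurableSingletonClass_of_coding hPi hF hSSC hPim
  have hχ2 : χ₂ < 0 := hχ21.trans_lt hχ1
  have hemb : MeasurableEmbedding Pi := hPim.measurableEmbedding (coding_injective hPi hF hSSC)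
  rw [ExactDim2, hemb.ae_map_iff]
  filter_upwards [ae_measure_cyl_pos (m := m), hent, hly1, hly2,
    ae_return_to_uniform_dimension hPi hPim hshift hproj] with ii h1 h2 h3 h4 h5
  rw [show h / χ₂ + (χ₂ - χ₁) / χ₂ * t = (h + (χ₂ - χ₁) * t) / χ₂ by ring]
  exact tendsto_local_dimension hPi hF hSSC hPim hQB hχ2 h1 h2 h3 h4 h5
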